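/- Let K be a field and Λ a finite-dimensional K-algebra that is hereditary (every Λ-submodule of a projective Λ-module is projective; equivalently, Ext²_Λ vanishes identically) and τ-tilting finite, and let 𝒯 be a torsion class of finite-dimensional right Λ-modules. Then 𝒯 lies in the image of pop↓ : tors Λ → tors Λ if and only if both of the following hold: (1) Ext¹_Λ(X, X′) = 0 for all X, X′ ∈ 𝒟(𝒯); and (2) 𝒯 contains no nonzero projective Λ-module. Dually, 𝒯 lies in the image of pop↑ : tors Λ → tors Λ if and only if Ext¹_Λ(Y, Y′) = 0 for all Y, Y′ ∈ 𝒰(𝒯) and 𝒯⊥ contains no nonzero injective Λ-module. -/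

import Mathlib

namespace PaperTors

universe u

variable (K : Type u) [Field K] (Λ : Type u) [Ring Λ] [Algebra K Λ]

/-- The category of finite-dimensional right `Λ`-modules is modeled as bundled left modules over
the opposite algebra `Λᵐᵒᵖ` (a right `Λ`-module is the same thing as a left `Λᵐᵒᵖ`-module). -/
abbrev RMod := ModuleCat.{u} Λᵐᵒᵖ

/-- `M` is finite-dimensional over `K` (with the `K`-action obtained through the algebra map
`K → Λᵐᵒᵖ`). -/
def IsFinDim (M : RMod Λ) : Prop :=
  letI : Module K M := Module.compHom M (algebraMap K Λᵐᵒᵖ)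
  FiniteDimensional K M

/-- `𝒯` is a torsion class of finite-dimensional right `Λ`-modules: a class of modules, closed
under isomorphism, consisting of finite-dimensional modules, containing the zero module, and
closed under quotient modules and under extensions. -/
structure IsTorsionClass (𝒯 : Set (RMod Λ)) : Prop where
  iso_closed : ∀ M N : RMod Λ, (M ≃ₗ[Λᵐᵒᵖ] N) → M ∈ 𝒯 → N ∈ 𝒯
  finDim : ∀ M ∈ 𝒯, IsFinDim K Λ M
  zero_mem : ∀ M : RMod Λ, Subsingleton M → M ∈ 𝒯
  quot_closed : ∀ (M N : RMod Λ) (f : M →ₗ[Λᵐᵒᵖ] N), Function.Surjective f → M ∈ 𝒯 → N ∈ 𝒯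
  ext_closed : ∀ (M : RMod Λ) (A : Submodule Λᵐᵒᵖ M),
    ModuleCat.of Λᵐᵒᵖ A ∈ 𝒯 → ModuleCat.of Λᵐᵒᵖ (M ⧸ A) ∈ 𝒯 → M ∈ 𝒯

/-- The lattice of torsion classes `tors Λ`, ordered by inclusion. -/
def TorsionClass : Type (u + 1) := {𝒯 : Set (RMod Λ) // IsTorsionClass K Λ 𝒯}

instance : PartialOrder (TorsionClass K Λ) := Subtype.partialOrder _

/-- `y` is the image of `x` under the pop-stack operator: `y` is the meet (the greatest lower
bound) of the set consisting of `x` together with all elements covered by `x`. -/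
def IsPopDown {α : Type*} [PartialOrder α] (x y : α) : Prop :=
  IsGLB (insert x {z | z ⋖ x}) y

/-- `y` is the image of `x` under the dual pop-stack operator: `y` is the join (the least upper
bound) of the set consisting of `x` together with all elements covering `x`. -/
def IsPopUp {α : Type*} [PartialOrder α] (x y : α) : Prop :=
  IsLUB (insert x {z | x ⋖ z}) y

variable {K}

/-- `W_L(𝒯)`: modules `M ∈ 𝒯` such that the kernel of any homomorphism from a module of `𝒯`
to `M` again lies in `𝒯`. -/
def WLower (𝒯 : Set (RMod Λ)) : Set (RMod Λ) :=
  {M | M ∈ 𝒯 ∧ ∀ N : RMod Λ, N ∈ 𝒯 → ∀ f : N →ₗ[Λᵐᵒᵖ] M,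
    ModuleCat.of Λᵐᵒᵖ (LinearMap.ker f) ∈ 𝒯}

/-- `𝒟(𝒯)`: the nonzero modules of `W_L(𝒯)` having no proper nonzero submodule belonging to
`W_L(𝒯)` (the brick labels of the cover relations below `𝒯`). -/
def DSet (𝒯 : Set (RMod Λ)) : Set (RMod Λ) :=
  {M | M ∈ WLower Λ 𝒯 ∧ (∃ m : M, m ≠ 0) ∧
    ∀ N : Submodule Λᵐᵒᵖ M, ModuleCat.of Λᵐᵒᵖ N ∈ WLower Λ 𝒯 → N = ⊥ ∨ N = ⊤}

/-- `𝒯⊥`: the modules admitting no nonzero homomorphism from any module of `𝒯`. -/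
def Perp (𝒯 : Set (RMod Λ)) : Set (RMod Λ) :=
  {M | ∀ T : RMod Λ, T ∈ 𝒯 → ∀ f : T →ₗ[Λᵐᵒᵖ] M, f = 0}

/-- `W_U(𝒯)`: modules `M ∈ 𝒯⊥` such that the cokernel of any homomorphism from `M` to a module
of `𝒯⊥` again lies in `𝒯⊥`. -/
def WUpper (𝒯 : Set (RMod Λ)) : Set (RMod Λ) :=
  {M | M ∈ Perp Λ 𝒯 ∧ ∀ N : RMod Λ, N ∈ Perp Λ 𝒯 → ∀ f : M →ₗ[Λᵐᵒᵖ] N,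
    ModuleCat.of Λᵐᵒᵖ (N ⧸ LinearMap.range f) ∈ Perp Λ 𝒯}

/-- `𝒰(𝒯)`: the nonzero modules of `W_U(𝒯)` having no proper nonzero submodule belonging to
`W_U(𝒯)` (the brick labels of the cover relations above `𝒯`). -/
def USet (𝒯 : Set (RMod Λ)) : Set (RMod Λ) :=
  {M | M ∈ WUpper Λ 𝒯 ∧ (∃ m : M, m ≠ 0) ∧
    ∀ N : Submodule Λᵐᵒᵖ M, ModuleCat.of Λᵐᵒᵖ N ∈ WUpper Λ 𝒯 → N = ⊥ ∨ N = ⊤}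

/-- `Filt(𝒞)`: modules admitting a finite filtration by submodules whose successive quotients
are isomorphic to modules in `𝒞`. -/
def FiltSet (𝒞 : Set (RMod Λ)) : Set (RMod Λ) :=
  {M | ∃ (r : ℕ) (c : Fin (r + 1) → Submodule Λᵐᵒᵖ M), Monotone c ∧
    c 0 = ⊥ ∧ c (Fin.last r) = ⊤ ∧
    ∀ i : Fin r, ∃ C ∈ 𝒞, Nonempty
      ((↥(c i.succ) ⧸ Submodule.comap (c i.succ).subtype (c i.castSucc)) ≃ₗ[Λᵐᵒᵖ] C)}


section Basics

variable {R : Type u} [Ring R]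

/-- Length of a module as a natural number. -/
noncomputable def len (R : Type u) [Ring R] (M : Type u) [AddCommGroup M] [Module R M] : ℕ :=
  (Module.length R M).toNat

section
variable [IsArtinianRing R] {M N : Type u} [AddCommGroup M] [Module R M] [AddCommGroup N]
  [Module R N]

lemma len_lt_of_inj [Module.Finite R M] (f : N →ₗ[R] M) (hf : Function.Injective f)
    (hr : LinearMap.range f ≠ ⊤) : len R N < len R M := by
  have h1 : Module.length R N = Module.length R (LinearMap.range f) :=
    (LinearEquiv.ofInjective f hf).length_eq
  have h2 := Submodule.length_lt hr
  unfold len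
  rw [h1]
  rw [← ENat.natCast_lt_natCast, ENat.natCast_toNat (ne_top_of_lt h2), ENat.natCast_toNat Module.length_ne_top]
  exact h2

lemma len_lt_of_surj [Module.Finite R M] (f : M →ₗ[R] N) (hf : Function.Surjective f)
    (hr : LinearMap.ker f ≠ ⊥) : len R N < len R M := by
  have h1 : Module.length R (M ⧸ LinearMap.ker f) = Module.length R N :=
    (f.quotKerEquivOfSurjective hf).length_eq
  have h2 := Submodule.length_quotient_lt _ hr
  unfold len
  rw [← h1]
  rw [← ENat.natCast_lt_natCast, ENat.natCast_toNat (ne_top_of_lt h2), ENat.natCast_toNat Module.length_ne_top]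
  exact h2

lemma len_lt_sub [Module.Finite R M] {A : Submodule R M} (h : A ≠ ⊤) : len R A < len R M :=
  len_lt_of_inj A.subtype A.injective_subtype (by simpa using h)

lemma len_lt_quot [Module.Finite R M] {A : Submodule R M} (h : A ≠ ⊥) :
    len R (M ⧸ A) < len R M :=
  len_lt_of_surj A.mkQ A.mkQ_surjective (by simpa using h)
end

section
variable {A B M N : Type u} [AddCommGroup A] [Module R A] [AddCommGroup B] [Module R B]
  [AddCommGroup M] [Module R M] [AddCommGroup N] [Module R N]

lemma factor (s : A →ₗ[R] B) (hs : Function.Surjective s) (φ : A →ₗ[R] M)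
    (h : LinearMap.ker s ≤ LinearMap.ker φ) : ∃ ψ : B →ₗ[R] M, ψ.comp s = φ := by
  refine ⟨((LinearMap.ker s).liftQ φ h).comp (s.quotKerEquivOfSurjective hs).symm.toLinearMap, ?_⟩
  ext a
  have : (s.quotKerEquivOfSurjective hs).symm (s a) = (LinearMap.ker s).mkQ a := by
    rw [LinearEquiv.symm_apply_eq]; rfl
  simp [this]

lemma cofactor (i : A →ₗ[R] B) (hi : Function.Injective i) (φ : M →ₗ[R] B)
    (h : LinearMap.range φ ≤ LinearMap.range i) : ∃ ψ : M →ₗ[R] A, i.comp ψ = φ := by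
  refine ⟨(LinearEquiv.ofInjective i hi).symm.toLinearMap.comp
    (φ.codRestrict (LinearMap.range i) (fun x => h ⟨x, rfl⟩)), ?_⟩
  ext m
  have := LinearEquiv.apply_symm_apply (LinearEquiv.ofInjective i hi)
    (φ.codRestrict (LinearMap.range i) (fun x => h ⟨x, rfl⟩) m)
  exact congrArg Subtype.val this

end

/-- Torsion classes, generic version. -/
structure Tors (T : Set (ModuleCat.{u} R)) : Prop where
  fin : ∀ M ∈ T, Module.Finite R M
  zero : ∀ M : ModuleCat.{u} R, Subsingleton M → M ∈ T
  quot : ∀ (M N : ModuleCat.{u} R) (f : M →ₗ[R] N), Function.Surjective f → M ∈ T → N ∈ T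
  ext : ∀ (M : ModuleCat.{u} R) (A : Submodule R M),
    ModuleCat.of R A ∈ T → ModuleCat.of R (M ⧸ A) ∈ T → M ∈ T

/-- Torsion-free classes (of finite modules), generic version. -/
structure TF (F : Set (ModuleCat.{u} R)) : Prop where
  fin : ∀ M ∈ F, Module.Finite R M
  zero : ∀ M : ModuleCat.{u} R, Subsingleton M → M ∈ F
  sub : ∀ (M N : ModuleCat.{u} R) (f : M →ₗ[R] N), Function.Injective f → N ∈ F → M ∈ F
  ext : ∀ (M : ModuleCat.{u} R) (A : Submodule R M),
    ModuleCat.of R A ∈ F → ModuleCat.of R (M ⧸ A) ∈ F → M ∈ F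

variable {T S F : Set (ModuleCat.{u} R)}

section
variable {A M N C : Type u} [AddCommGroup A] [Module R A] [AddCommGroup C] [Module R C]
  [AddCommGroup M] [Module R M] [AddCommGroup N] [Module R N]

lemma Tors.quot' (hT : Tors T) (f : M →ₗ[R] N) (hf : Function.Surjective f)
    (hM : ModuleCat.of R M ∈ T) : ModuleCat.of R N ∈ T :=
  hT.quot (ModuleCat.of R M) (ModuleCat.of R N) f hf hM

lemma Tors.fin' (hT : Tors T) (hM : ModuleCat.of R M ∈ T) : Module.Finite R M :=
  hT.fin _ hM

lemma Tors.zero' (hT : Tors T) [h : Subsingleton M] : ModuleCat.of R M ∈ T :=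
  hT.zero (ModuleCat.of R M) h

lemma Tors.iso (hT : Tors T) (e : M ≃ₗ[R] N) (hM : ModuleCat.of R M ∈ T) :
    ModuleCat.of R N ∈ T := hT.quot' e.toLinearMap e.surjective hM

lemma Tors.range (hT : Tors T) (f : M →ₗ[R] N) (hM : ModuleCat.of R M ∈ T) :
    ModuleCat.of R (LinearMap.range f) ∈ T :=
  hT.quot' f.rangeRestrict f.surjective_rangeRestrict hM

lemma Tors.ext' (hT : Tors T) (i : A →ₗ[R] M) (p : M →ₗ[R] C) (hp : Function.Surjective p)
    (h : LinearMap.ker p ≤ LinearMap.range i) (hA : ModuleCat.of R A ∈ T)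
    (hC : ModuleCat.of R C ∈ T) : ModuleCat.of R M ∈ T := by
  refine hT.ext (ModuleCat.of R M) (LinearMap.range i) (hT.range i hA) ?_
  obtain ⟨ψ, hψ⟩ := factor p hp (LinearMap.range i).mkQ (by simpa using h)
  refine hT.quot' ψ ?_ hC
  intro y
  obtain ⟨m, rfl⟩ := (LinearMap.range i).mkQ_surjective y
  exact ⟨p m, LinearMap.congr_fun hψ m⟩

lemma TF.sub' (hF : TF F) (f : M →ₗ[R] N) (hf : Function.Injective f)
    (hN : ModuleCat.of R N ∈ F) : ModuleCat.of R M ∈ F :=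
  hF.sub (ModuleCat.of R M) (ModuleCat.of R N) f hf hN

lemma TF.fin' (hF : TF F) (hM : ModuleCat.of R M ∈ F) : Module.Finite R M :=
  hF.fin _ hM

lemma TF.zero' (hF : TF F) [h : Subsingleton M] : ModuleCat.of R M ∈ F :=
  hF.zero (ModuleCat.of R M) h

lemma TF.iso (hF : TF F) (e : M ≃ₗ[R] N) (hM : ModuleCat.of R M ∈ F) :
    ModuleCat.of R N ∈ F := hF.sub' e.symm.toLinearMap e.symm.injective hM

lemma TF.range (hF : TF F) (f : M →ₗ[R] N) (hN : ModuleCat.of R N ∈ F) :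
    ModuleCat.of R (LinearMap.range f) ∈ F :=
  hF.sub' (LinearMap.range f).subtype (Submodule.injective_subtype _) hN

lemma TF.ext' (hF : TF F) (i : A →ₗ[R] M) (p : M →ₗ[R] C) (hi : Function.Injective i)
    (h : LinearMap.ker p ≤ LinearMap.range i) (hA : ModuleCat.of R A ∈ F)
    (hC : ModuleCat.of R C ∈ F) : ModuleCat.of R M ∈ F := by
  refine hF.ext (ModuleCat.of R M) (LinearMap.ker p) ?_
    (hF.iso p.quotKerEquivRange.symm (hF.range p hC))
  obtain ⟨ψ, hψ⟩ := cofactor i hi (LinearMap.ker p).subtype (by simpa using h)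
  refine hF.sub' ψ ?_ hA
  have : Function.Injective (i.comp ψ) := by rw [hψ]; exact Submodule.injective_subtype _
  exact Function.Injective.of_comp (f := i) (by simpa using this)

end

/-- Right perpendicular. -/
def RPerp (T : Set (ModuleCat.{u} R)) : Set (ModuleCat.{u} R) :=
  {M | ∀ X : ModuleCat.{u} R, X ∈ T → ∀ f : X →ₗ[R] M, f = 0}

/-- Left perpendicular. -/
def LPerp (F : Set (ModuleCat.{u} R)) : Set (ModuleCat.{u} R) :=
  {M | ∀ X : ModuleCat.{u} R, X ∈ F → ∀ f : M →ₗ[R] X, f = 0}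

section
variable {A M N C : Type u} [AddCommGroup A] [Module R A] [AddCommGroup C] [Module R C]
  [AddCommGroup M] [Module R M] [AddCommGroup N] [Module R N]

lemma RPerp.zero' (hM : ModuleCat.of R M ∈ RPerp T) (hN : ModuleCat.of R N ∈ T)
    (f : N →ₗ[R] M) : f = 0 := hM (ModuleCat.of R N) hN f

lemma LPerp.zero' (hM : ModuleCat.of R M ∈ LPerp F) (hN : ModuleCat.of R N ∈ F)
    (f : M →ₗ[R] N) : f = 0 := hM (ModuleCat.of R N) hN f

lemma subsing_of_id (h : (LinearMap.id : M →ₗ[R] M) = 0) : Subsingleton M :=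
  ⟨fun a b => by
    have ha := LinearMap.congr_fun h a
    have hb := LinearMap.congr_fun h b
    simp at ha hb; rw [ha, hb]⟩

lemma RPerp.inter (hM : ModuleCat.of R M ∈ RPerp T) (hN : ModuleCat.of R M ∈ T) :
    Subsingleton M := subsing_of_id (RPerp.zero' hM hN _)

lemma LPerp.inter (hM : ModuleCat.of R M ∈ LPerp F) (hN : ModuleCat.of R M ∈ F) :
    Subsingleton M := subsing_of_id (LPerp.zero' hM hN _)

lemma RPerp.sub (hN : ModuleCat.of R N ∈ RPerp T) (f : M →ₗ[R] N) (hf : Function.Injective f) :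
    ModuleCat.of R M ∈ RPerp T := by
  intro X hX g
  have := hN X hX (f.comp g)
  ext x
  exact hf (by simpa using LinearMap.congr_fun this x)

lemma LPerp.quot (hM : ModuleCat.of R M ∈ LPerp F) (f : M →ₗ[R] N) (hf : Function.Surjective f) :
    ModuleCat.of R N ∈ LPerp F := by
  intro X hX g
  have := hM X hX (g.comp f)
  ext x
  obtain ⟨y, rfl⟩ := hf x
  simpa using LinearMap.congr_fun this y

lemma RPerp.ext (i : A →ₗ[R] M) (p : M →ₗ[R] C) (hi : Function.Injective i)
    (h : LinearMap.ker p ≤ LinearMap.range i) (hA : ModuleCat.of R A ∈ RPerp T)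
    (hC : ModuleCat.of R C ∈ RPerp T) : ModuleCat.of R M ∈ RPerp T := by
  intro X hX g
  have h1 := hC X hX (p.comp g)
  obtain ⟨ψ, hψ⟩ := cofactor i hi g (by
    rintro _ ⟨x, rfl⟩
    exact h (by simpa using LinearMap.congr_fun h1 x))
  rw [← hψ, hA X hX ψ]
  simp

lemma LPerp.ext (i : A →ₗ[R] M) (p : M →ₗ[R] C) (hp : Function.Surjective p)
    (h : LinearMap.ker p ≤ LinearMap.range i) (hA : ModuleCat.of R A ∈ LPerp F)
    (hC : ModuleCat.of R C ∈ LPerp F) : ModuleCat.of R M ∈ LPerp F := by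
  intro X hX g
  have h1 := hA X hX (g.comp i)
  obtain ⟨ψ, hψ⟩ := factor p hp g (by
    intro x hx
    obtain ⟨a, rfl⟩ := h hx
    simpa using LinearMap.congr_fun h1 a)
  rw [← hψ, hC X hX ψ]
  simp

/-- The torsion submodule. -/
lemma radical [IsNoetherian R M] (hT : Tors T) : ∃ A : Submodule R M, ModuleCat.of R A ∈ T ∧
    ModuleCat.of R (M ⧸ A) ∈ RPerp T := by
  obtain ⟨A, hA, hmax⟩ := (wellFounded_gt (α := Submodule R M)).has_min
    {A | ModuleCat.of R A ∈ T} ⟨⊥, hT.zero'⟩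
  refine ⟨A, hA, ?_⟩
  intro X hX f
  set I := LinearMap.range f with hI
  have hI' : ModuleCat.of R I ∈ T := hT.range f hX
  have hle : A ≤ I.comap A.mkQ := by
    intro x hx
    have : A.mkQ x = 0 := by simpa using hx
    simp [Submodule.mem_comap, (Submodule.Quotient.mk_eq_zero A).2 hx]
  have hA' : ModuleCat.of R (I.comap A.mkQ) ∈ T := by
    refine hT.ext' (Submodule.inclusion hle)
      ((A.mkQ.comp (I.comap A.mkQ).subtype).codRestrict I (fun x => x.2)) ?_ ?_ hA hI'
    · rintro ⟨y, hy⟩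
      obtain ⟨m, rfl⟩ := A.mkQ_surjective y
      exact ⟨⟨m, hy⟩, rfl⟩
    · rintro ⟨x, hx⟩ hx'
      have : A.mkQ x = 0 := congrArg Subtype.val hx'
      exact ⟨⟨x, by simpa using this⟩, rfl⟩
  have hEq : I.comap A.mkQ = A := by
    by_contra hne
    exact hmax _ hA' (lt_of_le_of_ne hle (Ne.symm hne))
  ext x
  obtain ⟨m, hm⟩ := A.mkQ_surjective (f x)
  have : m ∈ I.comap A.mkQ := by
    change A.mkQ m ∈ I
    rw [hm]; exact ⟨x, rfl⟩
  rw [hEq] at this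
  rw [← hm]
  simpa using this

/-- The dual torsion submodule for torsion-free classes. -/
lemma coradical [IsArtinian R M] (hF : TF F) : ∃ A : Submodule R M,
    ModuleCat.of R (M ⧸ A) ∈ F ∧ ModuleCat.of R A ∈ LPerp F := by
  have h0 : ModuleCat.of R (M ⧸ (⊤ : Submodule R M)) ∈ F := hF.zero'
  obtain ⟨A, hA, hmin⟩ := (wellFounded_lt (α := Submodule R M)).has_min
    {A | ModuleCat.of R (M ⧸ A) ∈ F} ⟨⊤, h0⟩
  refine ⟨A, hA, ?_⟩
  intro X hX f
  set B := (LinearMap.ker f).map A.subtype with hB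
  have hle : B ≤ A := Submodule.map_subtype_le _ _
  have hB' : ModuleCat.of R (M ⧸ B) ∈ F := by
    obtain ⟨ψ, hψ⟩ := factor B.mkQ B.mkQ_surjective A.mkQ (by simpa using hle)
    refine hF.ext' (A := (A ⧸ LinearMap.ker f))
      ((LinearMap.ker f).mapQ B A.subtype (Submodule.le_comap_map _ _)) ψ ?_ ?_
      (hF.iso f.quotKerEquivRange.symm (hF.range f hX)) hA
    · rw [← LinearMap.ker_eq_bot, Submodule.ker_mapQ]
      have : Submodule.comap A.subtype B = LinearMap.ker f :=
        Submodule.comap_map_eq_of_injective A.injective_subtype _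
      rw [this, Submodule.mkQ_map_self]
    · intro y hy
      obtain ⟨m, rfl⟩ := B.mkQ_surjective y
      have : A.mkQ m = 0 := by rw [← hψ]; exact hy
      have hm : m ∈ A := by simpa using this
      exact ⟨(LinearMap.ker f).mkQ ⟨m, hm⟩, rfl⟩
  have hEq : B = A := by
    by_contra hne
    exact hmin _ hB' (lt_of_le_of_ne hle hne)
  ext x
  have : (x : M) ∈ B := by rw [hEq]; exact x.2
  obtain ⟨y, hy, hxy⟩ := this
  have : y = x := Subtype.ext hxy
  rw [← this]
  exact hy

end
end Basics

section CoversT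

variable {R : Type u} [Ring R]

/-- Generic `W_L`. -/
def WL (T : Set (ModuleCat.{u} R)) : Set (ModuleCat.{u} R) :=
  {M | M ∈ T ∧ ∀ N : ModuleCat.{u} R, N ∈ T → ∀ f : N →ₗ[R] M,
    ModuleCat.of R (LinearMap.ker f) ∈ T}

/-- Generic `𝒟`. -/
def DS (T : Set (ModuleCat.{u} R)) : Set (ModuleCat.{u} R) :=
  {M | M ∈ WL T ∧ (∃ m : M, m ≠ 0) ∧
    ∀ N : Submodule R M, ModuleCat.of R N ∈ WL T → N = ⊥ ∨ N = ⊤}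

/-- Lattice of generic torsion classes. -/
def TorsC (R : Type u) [Ring R] : Type (u + 1) := {T : Set (ModuleCat.{u} R) // Tors T}

instance : PartialOrder (TorsC R) := Subtype.partialOrder _

variable {T S : Set (ModuleCat.{u} R)}

section
variable {X M N : Type u} [AddCommGroup X] [Module R X] [AddCommGroup M] [Module R M]
  [AddCommGroup N] [Module R N]

lemma WL.ker (hX : ModuleCat.of R X ∈ WL T) (hM : ModuleCat.of R M ∈ T) (f : M →ₗ[R] X) :
    ModuleCat.of R (LinearMap.ker f) ∈ T := hX.2 (ModuleCat.of R M) hM f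

lemma WL.sub (hX : ModuleCat.of R X ∈ WL T) {A : Submodule R X} (hA : ModuleCat.of R A ∈ T) :
    ModuleCat.of R A ∈ WL T := by
  refine ⟨hA, fun N hN f => ?_⟩
  have := hX.2 N hN (A.subtype.comp f)
  rwa [LinearMap.ker_comp_of_ker_eq_bot _ (by simp)] at this

lemma DS.zero_or_surj (hT : Tors T) (hX : ModuleCat.of R X ∈ DS T) (hM : ModuleCat.of R M ∈ T)
    (f : M →ₗ[R] X) : f = 0 ∨ Function.Surjective f := by
  rcases hX.2.2 (LinearMap.range f) (WL.sub hX.1 (hT.range f hM)) with h | h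
  · left; exact LinearMap.range_eq_bot.1 h
  · right; exact LinearMap.range_eq_top.1 h

lemma DS.ne_zero (hX : ModuleCat.of R X ∈ DS T) : ¬ Subsingleton X := by
  intro h
  obtain ⟨m, hm⟩ := hX.2.1
  exact hm (@Subsingleton.elim X h m 0)

lemma DS.bij (hT : Tors T) (hX : ModuleCat.of R X ∈ DS T) (hM : ModuleCat.of R M ∈ DS T)
    (f : M →ₗ[R] X) (hf : f ≠ 0) : Function.Bijective f := by
  have hs := (DS.zero_or_surj hT hX hM.1.1 f).resolve_left hf
  refine ⟨?_, hs⟩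
  rcases hM.2.2 (LinearMap.ker f) (WL.sub hM.1 (WL.ker hX.1 hM.1.1 f)) with h | h
  · exact LinearMap.ker_eq_bot.1 h
  · exact absurd (LinearMap.ker_eq_top.1 h) hf

end

/-- The torsion class `T ∩ ⊥X`. -/
def Cut (T : Set (ModuleCat.{u} R)) (X : ModuleCat.{u} R) : Set (ModuleCat.{u} R) :=
  {M | M ∈ T ∧ ∀ f : M →ₗ[R] X, f = 0}

/-- Intersections with left perpendiculars are torsion classes. -/
lemma tors_inter_lperp (hT : Tors T) (F : Set (ModuleCat.{u} R)) : Tors (T ∩ LPerp F) where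
  fin M hM := hT.fin M hM.1
  zero M hM := ⟨hT.zero M hM, fun X _ f => by
    ext x; rw [@Subsingleton.elim M hM x 0]; simp⟩
  quot M N f hf hM := ⟨hT.quot M N f hf hM.1, LPerp.quot hM.2 f hf⟩
  ext M A hA hC := ⟨hT.ext M A hA.1 hC.1, LPerp.ext A.subtype A.mkQ A.mkQ_surjective
    (by simp) hA.2 hC.2⟩

lemma cut_eq (X : ModuleCat.{u} R) : Cut T X = T ∩ LPerp {X} := by
  ext M
  constructor
  · rintro ⟨h1, h2⟩
    exact ⟨h1, fun Y hY f => by cases hY; exact h2 f⟩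
  · rintro ⟨h1, h2⟩
    exact ⟨h1, fun f => h2 X rfl f⟩

lemma tors_cut (hT : Tors T) (X : ModuleCat.{u} R) : Tors (Cut T X) := by
  rw [cut_eq]; exact tors_inter_lperp hT _

lemma tors_fin : Tors {M : ModuleCat.{u} R | Module.Finite R M} where
  fin M hM := hM
  zero M hM := by
    have : Finite M := Finite.of_subsingleton
    exact (inferInstance : Module.Finite R M)
  quot M N f hf hM := by
    have : Module.Finite R M := hM
    exact Module.Finite.of_surjective f hf
  ext M A hA hC := by
    have : Module.Finite R A := hA
    have : Module.Finite R (M ⧸ A) := hC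
    exact Module.Finite.of_submodule_quotient A

lemma exists_min_len {P : ModuleCat.{u} R → Prop} (h : ∃ M, P M) :
    ∃ M, P M ∧ ∀ N, P N → len R M ≤ len R N := by
  classical
  have h' : ∃ n, ∃ M, P M ∧ len R M = n := by
    obtain ⟨M, hM⟩ := h; exact ⟨_, M, hM, rfl⟩
  obtain ⟨M, hM, hl⟩ := Nat.find_spec h'
  exact ⟨M, hM, fun N hN => hl ▸ Nat.find_min' h' ⟨N, hN, rfl⟩⟩

variable [IsArtinianRing R]

lemma cut_covBy (T : TorsC R) {X : ModuleCat.{u} R} (hX : X ∈ DS T.1) :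
    (⟨Cut T.1 X, tors_cut T.2 X⟩ : TorsC R) ⋖ T := by
  have hXT : X ∈ T.1 := hX.1.1
  constructor
  · refine lt_of_le_of_ne (fun M hM => hM.1) ?_
    intro h
    have : X ∈ Cut T.1 X := by
      have h' : Cut T.1 X = T.1 := congrArg Subtype.val h
      rw [h']; exact hXT
    exact DS.ne_zero hX (subsing_of_id (this.2 LinearMap.id))
  · intro U h1 h2
    have h1' : ∃ M ∈ U.1, M ∉ Cut T.1 X := by
      by_contra hcon
      push Not at hcon
      exact absurd h1 (not_lt_of_ge hcon)
    have hUT : U.1 ⊆ T.1 := h2.le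
    have hXU : X ∈ U.1 := by
      obtain ⟨M, hM, hMX⟩ := h1'
      have : ∃ f : M →ₗ[R] X, f ≠ 0 := by
        by_contra hcon
        push Not at hcon
        exact hMX ⟨hUT hM, hcon⟩
      obtain ⟨f, hf⟩ := this
      exact U.2.quot M X f ((DS.zero_or_surj T.2 hX (hUT hM) f).resolve_left hf) hM
    have key : ∀ n : ℕ, ∀ N : ModuleCat.{u} R, len R N = n → N ∈ T.1 → N ∈ U.1 := by
      intro n
      induction n using Nat.strong_induction_on with
      | _ n ih =>
        intro N hn hN
        by_cases hc : ∀ f : N →ₗ[R] X, f = 0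
        · exact h1.le ⟨hN, hc⟩
        · push Not at hc
          obtain ⟨f, hf⟩ := hc
          have hs := (DS.zero_or_surj T.2 hX hN f).resolve_left hf
          have hfin : Module.Finite R N := T.2.fin N hN
          have hlt : len R (LinearMap.ker f) < len R N :=
            len_lt_sub (fun h => hf (LinearMap.ker_eq_top.1 h))
          have hk := ih _ (hn ▸ hlt) (ModuleCat.of R (LinearMap.ker f)) rfl (hX.1.2 N hN f)
          exact U.2.ext' (M := N) (LinearMap.ker f).subtype f hs (by simp) hk hXU
    exact absurd h2 (not_lt_of_ge (fun N hN => key _ N rfl hN))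

lemma covBy_cut {S T : TorsC R} (h : S ⋖ T) : ∃ X ∈ DS T.1, S.1 = Cut T.1 X := by
  have hST : S.1 ⊆ T.1 := h.1.le
  have hex : ∃ X : ModuleCat.{u} R, X ∈ T.1 ∧ X ∈ RPerp S.1 ∧ ¬ Subsingleton X := by
    have : ∃ M ∈ T.1, M ∉ S.1 := by
      by_contra hcon
      push Not at hcon
      exact absurd h.1 (not_lt_of_ge hcon)
    obtain ⟨M, hM, hMS⟩ := this
    have hfin : Module.Finite R M := T.2.fin M hM
    obtain ⟨A, hA, hA'⟩ := radical (M := M) S.2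
    refine ⟨ModuleCat.of R (M ⧸ A), T.2.quot' A.mkQ A.mkQ_surjective hM, hA', ?_⟩
    intro hs
    exact hMS (S.2.ext M A hA (S.2.zero _ hs))
  obtain ⟨X, ⟨hXT, hXS, hX0⟩, hmin⟩ := exists_min_len hex
  have hXfin : Module.Finite R X := T.2.fin X hXT
  have hXnS : X ∉ S.1 := fun hc => hX0 (RPerp.inter hXS hc)
  -- submodules of X in T
  have hsub : ∀ A : Submodule R X, ModuleCat.of R A ∈ T.1 → A = ⊥ ∨ A = ⊤ := by
    intro A hA
    by_contra hcon
    push Not at hcon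
    have h1 := hmin (ModuleCat.of R A) ⟨hA, RPerp.sub hXS A.subtype A.injective_subtype,
      fun hs => hcon.1 ((Submodule.subsingleton_iff_eq_bot).1 hs)⟩
    exact absurd (len_lt_sub hcon.2) (not_lt_of_ge h1)
  have hWL : X ∈ WL T.1 := by
    refine ⟨hXT, fun N hN f => ?_⟩
    rcases hsub (LinearMap.range f) (T.2.range f hN) with h0 | h0
    · have hf0 : f = 0 := LinearMap.range_eq_bot.1 h0
      subst hf0
      have : (LinearMap.ker (0 : N →ₗ[R] X)) = ⊤ := LinearMap.ker_zero
      rw [this]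
      exact T.2.iso (Submodule.topEquiv (R := R) (M := N)).symm hN
    have hsurj : Function.Surjective f := LinearMap.range_eq_top.1 h0
    have hNfin : Module.Finite R N := T.2.fin N hN
    obtain ⟨A, hA, hA'⟩ := radical (M := LinearMap.ker f) T.2
    set A1 : Submodule R N := A.map (LinearMap.ker f).subtype with hA1
    have hA1k : A1 ≤ LinearMap.ker f := Submodule.map_subtype_le _ _
    have hN1 : ModuleCat.of R (N ⧸ A1) ∈ T.1 := T.2.quot' A1.mkQ A1.mkQ_surjective hN
    obtain ⟨f1, hf1⟩ := factor A1.mkQ A1.mkQ_surjective f (by simpa using hA1k)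
    have hf1s : Function.Surjective f1 := by
      intro x; obtain ⟨n, rfl⟩ := hsurj x
      exact ⟨A1.mkQ n, LinearMap.congr_fun hf1 n⟩
    -- the kernel of f1 is torsion-free
    have hk1 : ModuleCat.of R (LinearMap.ker f1) ∈ RPerp T.1 := by
      intro Y hY g
      -- surjection ker f ⧸ A ≃ ker f1
      have hmem : ∀ x : LinearMap.ker f, A1.mkQ x ∈ LinearMap.ker f1 := by
        intro x
        have := LinearMap.congr_fun hf1 (x : N)
        have hx : f x = 0 := x.2
        simp only [LinearMap.comp_apply] at this
        rw [LinearMap.mem_ker, this, hx]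
      set q : LinearMap.ker f →ₗ[R] LinearMap.ker f1 :=
        (A1.mkQ.comp (LinearMap.ker f).subtype).codRestrict _ hmem with hq
      have hqs : Function.Surjective q := by
        rintro ⟨y, hy⟩
        obtain ⟨n, rfl⟩ := A1.mkQ_surjective y
        have : f n = 0 := by rw [← hf1]; exact hy
        exact ⟨⟨n, this⟩, rfl⟩
      have hqk : LinearMap.ker q = A := by
        ext x
        have : q x = 0 ↔ (x : N) ∈ A1 := by
          rw [← Submodule.Quotient.mk_eq_zero A1]
          exact ⟨fun hh => congrArg Subtype.val hh, fun hh => Subtype.ext hh⟩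
        rw [LinearMap.mem_ker, this, hA1]
        simp
      obtain ⟨ψ, hψ⟩ := factor q hqs A.mkQ (by simp [hqk])
      have h3 := hA' Y hY (ψ.comp g)
      ext y
      obtain ⟨x, hx⟩ := hqs (g y)
      have h4 : ψ (g y) = 0 := LinearMap.congr_fun h3 y
      rw [← hx] at h4
      have h5 : A.mkQ x = 0 := by rw [← hψ]; exact h4
      have h6 : x ∈ A := by simpa using h5
      rw [← hqk] at h6
      have h7 : q x = 0 := h6
      rw [← hx, h7]
      rfl
    -- N ⧸ A1 is S-torsion-free
    have hN1S : ModuleCat.of R (N ⧸ A1) ∈ RPerp S.1 := by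
      intro Y hY g
      have h1 : f1.comp g = 0 := hXS Y hY _
      obtain ⟨ψ, hψ⟩ := cofactor (LinearMap.ker f1).subtype (Submodule.injective_subtype _) g
        (by rintro _ ⟨y, rfl⟩; simpa using LinearMap.congr_fun h1 y)
      rw [← hψ, hk1 Y (hST hY) ψ]; simp
    -- a nonzero map X → N ⧸ A1
    have hg : ∃ g : X →ₗ[R] (N ⧸ A1), g ≠ 0 := by
      by_contra hcon
      push Not at hcon
      set G : Set (ModuleCat.{u} R) := {Z | Z ∈ RPerp S.1 ∧ ∀ g : X →ₗ[R] Z, g = 0}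
      have hle : S ≤ (⟨T.1 ∩ LPerp G, tors_inter_lperp T.2 G⟩ : TorsC R) := fun M hM =>
        ⟨hST hM, fun Z hZ f => hZ.1 M hM f⟩
      have hXG : X ∈ T.1 ∩ LPerp G := ⟨hXT, fun Z hZ f => hZ.2 f⟩
      have hlt : S < (⟨T.1 ∩ LPerp G, tors_inter_lperp T.2 G⟩ : TorsC R) :=
        lt_of_le_not_ge hle (fun hc => hXnS (hc hXG))
      have hge : T ≤ (⟨T.1 ∩ LPerp G, tors_inter_lperp T.2 G⟩ : TorsC R) := by
        by_contra hc
        exact h.2 hlt (lt_of_le_not_ge (fun M hM => hM.1) hc)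
      have h1 := (hge hN1).2
      have h2 : Subsingleton (N ⧸ A1) := LPerp.inter h1 ⟨hN1S, hcon⟩
      exact hX0 (hf1s.subsingleton)
    obtain ⟨g, hg⟩ := hg
    have hbij : Function.Surjective (f1.comp g) := by
      rcases hsub (LinearMap.range (f1.comp g)) (T.2.range _ hXT) with h1 | h1
      · exfalso
        have h1 : f1.comp g = 0 := LinearMap.range_eq_bot.1 h1
        obtain ⟨ψ, hψ⟩ := cofactor (LinearMap.ker f1).subtype (Submodule.injective_subtype _) g
          (by rintro _ ⟨y, rfl⟩; simpa using LinearMap.congr_fun h1 y)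
        apply hg
        rw [← hψ, hk1 X hXT ψ]; simp
      · exact LinearMap.range_eq_top.1 h1
    have hinj : Function.Injective (f1.comp g) :=
      IsNoetherian.injective_of_surjective_endomorphism _ hbij
    set e := LinearEquiv.ofBijective (f1.comp g) ⟨hinj, hbij⟩ with he
    set s : X →ₗ[R] (N ⧸ A1) := g.comp e.symm.toLinearMap with hs
    have hfs : ∀ x, f1 (s x) = x := fun x => e.apply_symm_apply x
    have hkT : ModuleCat.of R (LinearMap.ker f1) ∈ T.1 := by
      have hmm : ∀ c, ((LinearMap.id : (N ⧸ A1) →ₗ[R] (N ⧸ A1)) - s.comp f1) c ∈ LinearMap.ker f1 := by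
        intro c; simp [hfs]
      refine T.2.quot' ((LinearMap.id - s.comp f1).codRestrict (LinearMap.ker f1) hmm) ?_ hN1
      · rintro ⟨y, hy⟩
        refine ⟨y, Subtype.ext ?_⟩
        have : f1 y = 0 := hy
        simp [this]
    have hk0 : Subsingleton (LinearMap.ker f1) := RPerp.inter hk1 hkT
    have hAk : LinearMap.ker f ≤ A1 := by
      intro x hx
      have hxm : A1.mkQ x ∈ LinearMap.ker f1 := by
        have := LinearMap.congr_fun hf1 x
        have hx : f x = 0 := hx
        simp only [LinearMap.comp_apply] at this
        rw [LinearMap.mem_ker, this, hx]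
      have := congrArg Subtype.val
        (Subsingleton.elim (⟨A1.mkQ x, hxm⟩ : LinearMap.ker f1) 0)
      simpa using this
    refine T.2.iso ?_ hA
    refine (Submodule.equivSubtypeMap (LinearMap.ker f) A).trans
      (LinearEquiv.ofEq _ _ (le_antisymm hA1k hAk))
  have hD : X ∈ DS T.1 := by
    refine ⟨hWL, ?_, fun N hN => hsub N hN.1⟩
    by_contra hcon
    push Not at hcon
    exact hX0 ⟨fun a b => by rw [hcon a, hcon b]⟩
  refine ⟨X, hD, ?_⟩
  have hle : S ≤ (⟨Cut T.1 X, tors_cut T.2 X⟩ : TorsC R) := fun M hM =>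
    ⟨hST hM, fun f => hXS M hM f⟩
  have hlt := (cut_covBy T hD).1
  have : S = (⟨Cut T.1 X, tors_cut T.2 X⟩ : TorsC R) := by
    by_contra hne
    exact h.2 (lt_of_le_of_ne hle hne) hlt
  exact congrArg Subtype.val this

lemma le_of_DS [Finite (TorsC R)] (T S : TorsC R) (h : DS T.1 ⊆ S.1) : T ≤ S := by
  have hI : Tors (T.1 ∩ S.1) :=
    { fin := fun M hM => T.2.fin M hM.1
      zero := fun M hM => ⟨T.2.zero M hM, S.2.zero M hM⟩
      quot := fun M N f hf hM => ⟨T.2.quot M N f hf hM.1, S.2.quot M N f hf hM.2⟩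
      ext := fun M A hA hC => ⟨T.2.ext M A hA.1 hC.1, S.2.ext M A hA.2 hC.2⟩ }
  by_contra hne
  have hlt : (⟨T.1 ∩ S.1, hI⟩ : TorsC R) < T :=
    lt_of_le_not_ge (fun M hM => hM.1) (fun hc => hne (fun M hM => (hc hM).2))
  obtain ⟨U, hU1, hU2⟩ := exists_le_covBy_of_lt (α := TorsC R) hlt
  obtain ⟨X, hX, hXe⟩ := covBy_cut hU2
  have : X ∈ U.1 := hU1 ⟨hX.1.1, h hX⟩
  rw [hXe] at this
  exact DS.ne_zero hX (subsing_of_id (this.2 LinearMap.id))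

/-- The pop-stack image. -/
def Pop (T : Set (ModuleCat.{u} R)) : Set (ModuleCat.{u} R) := T ∩ LPerp (DS T)

lemma pop_isGLB (T : TorsC R) :
    IsGLB (insert T {z | z ⋖ T}) (⟨Pop T.1, tors_inter_lperp T.2 _⟩ : TorsC R) := by
  constructor
  · rintro z (rfl | hz)
    · exact fun M hM => hM.1
    · obtain ⟨X, hX, hXe⟩ := covBy_cut hz
      intro M hM
      rw [hXe]
      exact ⟨hM.1, hM.2 X hX⟩
  · intro z hz M hM
    refine ⟨hz (Set.mem_insert _ _) hM, fun X hX f => ?_⟩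
    have := hz (Set.mem_insert_of_mem _ (cut_covBy T hX)) hM
    exact this.2 f

lemma isGLB_iff_pop (T T0 : TorsC R) :
    IsGLB (insert T {z | z ⋖ T}) T0 ↔ T0.1 = Pop T.1 := by
  constructor
  · intro h
    exact congrArg Subtype.val (h.unique (pop_isGLB T))
  · intro h
    have : T0 = (⟨Pop T.1, tors_inter_lperp T.2 _⟩ : TorsC R) := Subtype.ext h
    rw [this]; exact pop_isGLB T

end CoversT

section ExtLemmas

variable {R : Type u} [Ring R]

/-- Vanishing of `Ext¹(X, Y)`. -/
def ExtZ (X Y : ModuleCat.{u} R) : Prop :=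
  ∀ (E : ModuleCat.{u} R) (i : Y →ₗ[R] E) (p : E →ₗ[R] X),
    Function.Injective i → Function.Surjective p → LinearMap.range i = LinearMap.ker p →
    ∃ s : X →ₗ[R] E, p.comp s = LinearMap.id

section
variable {X Y Z A B C P Q M N : Type u} [AddCommGroup X] [Module R X] [AddCommGroup Y] [Module R Y]
  [AddCommGroup Z] [Module R Z] [AddCommGroup A] [Module R A] [AddCommGroup B] [Module R B]
  [AddCommGroup C] [Module R C] [AddCommGroup P] [Module R P] [AddCommGroup Q] [Module R Q]
  [AddCommGroup M] [Module R M] [AddCommGroup N] [Module R N]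

lemma ExtZ.split {E : Type u} [AddCommGroup E] [Module R E]
    (h : ExtZ (ModuleCat.of R X) (ModuleCat.of R Y)) (i : Y →ₗ[R] E) (p : E →ₗ[R] X)
    (hi : Function.Injective i) (hp : Function.Surjective p)
    (hip : LinearMap.range i = LinearMap.ker p) : ∃ s : X →ₗ[R] E, p.comp s = LinearMap.id :=
  h (ModuleCat.of R E) i p hi hp hip

lemma retraction_of_section (i : A →ₗ[R] B) (p : B →ₗ[R] C) (hi : Function.Injective i)
    (hip : LinearMap.range i = LinearMap.ker p) (s : C →ₗ[R] B) (hs : p.comp s = LinearMap.id) :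
    ∃ r : B →ₗ[R] A, r.comp i = LinearMap.id := by
  obtain ⟨r, hr⟩ := cofactor i hi (LinearMap.id - s.comp p) (by
    rw [hip]
    rintro _ ⟨b, rfl⟩
    have := LinearMap.congr_fun hs (p b)
    simp only [LinearMap.comp_apply, LinearMap.id_apply] at this
    simp [this])
  refine ⟨r, ?_⟩
  ext a
  apply hi
  have h1 := LinearMap.congr_fun hr (i a)
  have h2 : p (i a) = 0 := by
    have : i a ∈ LinearMap.ker p := hip ▸ ⟨a, rfl⟩
    exact this
  simp only [LinearMap.comp_apply, LinearMap.sub_apply, LinearMap.id_apply, h2, map_zero,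
    sub_zero] at h1
  simpa using h1

lemma section_of_retraction (i : A →ₗ[R] B) (p : B →ₗ[R] C) (hp : Function.Surjective p)
    (hip : LinearMap.range i = LinearMap.ker p) (r : B →ₗ[R] A) (hr : r.comp i = LinearMap.id) :
    ∃ s : C →ₗ[R] B, p.comp s = LinearMap.id := by
  obtain ⟨s, hs⟩ := factor p hp (LinearMap.id - i.comp r) (by
    rw [← hip]
    rintro _ ⟨a, rfl⟩
    have := LinearMap.congr_fun hr a
    simp only [LinearMap.comp_apply, LinearMap.id_apply] at this
    simp [this])
  refine ⟨s, ?_⟩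
  ext c
  obtain ⟨b, rfl⟩ := hp c
  have h1 := LinearMap.congr_fun hs b
  simp only [LinearMap.comp_apply] at h1 ⊢
  rw [h1]
  have h2 : p (i (r b)) = 0 := by
    have : i (r b) ∈ LinearMap.ker p := hip ▸ ⟨r b, rfl⟩
    exact this
  simp [h2]

/-- Pushouts of extensions. -/
lemma pushout (i : A →ₗ[R] B) (p : B →ₗ[R] C) (hi : Function.Injective i)
    (hp : Function.Surjective p) (hip : LinearMap.range i = LinearMap.ker p) (φ : A →ₗ[R] M) :
    ∃ (E : ModuleCat.{u} R) (i' : M →ₗ[R] E) (p' : E →ₗ[R] C) (h : B →ₗ[R] E),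
      Function.Injective i' ∧ Function.Surjective p' ∧ LinearMap.range i' = LinearMap.ker p' ∧
      h.comp i = i'.comp φ ∧ p'.comp h = p := by
  set U : Submodule R (M × B) := LinearMap.range (φ.prod (-i)) with hU
  have hpi : ∀ a, p (i a) = 0 := fun a => by
    have : i a ∈ LinearMap.ker p := hip ▸ ⟨a, rfl⟩
    exact this
  have hle : U ≤ LinearMap.ker (p.comp (LinearMap.snd R M B)) := by
    rintro _ ⟨a, rfl⟩
    simp [hpi]
  refine ⟨ModuleCat.of R ((M × B) ⧸ U), U.mkQ.comp (LinearMap.inl R M B), U.liftQ _ hle,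
    U.mkQ.comp (LinearMap.inr R M B), ?_, ?_, ?_, ?_, ?_⟩
  · rw [← LinearMap.ker_eq_bot, LinearMap.ker_eq_bot']
    intro m hm
    have : (m, (0 : B)) ∈ U := by simpa using hm
    obtain ⟨a, ha⟩ := this
    have h1 : φ a = m := congrArg Prod.fst ha
    have h2 : - i a = 0 := congrArg Prod.snd ha
    have h3 : a = 0 := hi (by simpa using h2)
    rw [← h1, h3, map_zero]
  · intro c
    obtain ⟨b, rfl⟩ := hp c
    exact ⟨U.mkQ (0, b), rfl⟩
  · apply le_antisymm
    · rintro _ ⟨m, rfl⟩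
      simp
    · intro x hx
      obtain ⟨⟨m, b⟩, rfl⟩ := U.mkQ_surjective x
      have hb : p b = 0 := hx
      have : b ∈ LinearMap.range i := hip ▸ hb
      obtain ⟨a, rfl⟩ := this
      refine ⟨m + φ a, ?_⟩
      refine (Submodule.Quotient.eq U).2 ⟨a, ?_⟩
      simp
  · ext a
    refine (Submodule.Quotient.eq U).2 ⟨-a, ?_⟩
    simp
  · ext b
    rfl

/-- E5 -/
lemma ExtZ.extend (h : ExtZ (ModuleCat.of R C) (ModuleCat.of R M))
    (i : A →ₗ[R] B) (p : B →ₗ[R] C) (hi : Function.Injective i)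
    (hp : Function.Surjective p) (hip : LinearMap.range i = LinearMap.ker p) (φ : A →ₗ[R] M) :
    ∃ ψ : B →ₗ[R] M, ψ.comp i = φ := by
  obtain ⟨E, i', p', k, hi', hp', hip', h1, h2⟩ := pushout i p hi hp hip φ
  obtain ⟨s, hs⟩ := h E i' p' hi' hp' hip'
  obtain ⟨r, hr⟩ := retraction_of_section (R := R) i' p' hi' hip' s hs
  refine ⟨r.comp k, ?_⟩
  rw [LinearMap.comp_assoc, h1, ← LinearMap.comp_assoc, hr, LinearMap.id_comp]

lemma ExtZ.of_pres [Module.Projective R Q] (π : Q →ₗ[R] X) (hπ : Function.Surjective π)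
    (h : ∀ φ : LinearMap.ker π →ₗ[R] Y, ∃ ψ : Q →ₗ[R] Y,
      ψ.comp (LinearMap.ker π).subtype = φ) :
    ExtZ (ModuleCat.of R X) (ModuleCat.of R Y) := by
  intro E i p hi hp hip
  change Y →ₗ[R] E at i
  change E →ₗ[R] X at p
  obtain ⟨l, hl⟩ := Module.projective_lifting_property p π hp
  obtain ⟨φ, hφ⟩ := cofactor i hi (l.comp (LinearMap.ker π).subtype) (by
    rw [hip]
    rintro _ ⟨x, rfl⟩
    have := LinearMap.congr_fun hl (x : Q)
    simp only [LinearMap.comp_apply] at this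
    have hx : π x = 0 := x.2
    simp [this])
  obtain ⟨ψ, hψ⟩ := h φ
  obtain ⟨s, hs⟩ := factor π hπ (l - i.comp ψ) (by
    intro x hx
    have h1 := LinearMap.congr_fun hφ ⟨x, hx⟩
    have h2 := LinearMap.congr_fun hψ ⟨x, hx⟩
    simp only [LinearMap.comp_apply, Submodule.subtype_apply] at h1 h2
    simp [h2, h1])
  refine ⟨s, ?_⟩
  ext x
  obtain ⟨q, rfl⟩ := hπ x
  have h1 := LinearMap.congr_fun hs q
  have h2 := LinearMap.congr_fun hl q
  have h3 : p (i (ψ q)) = 0 := by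
    have : i (ψ q) ∈ LinearMap.ker p := hip ▸ ⟨ψ q, rfl⟩
    exact this
  simp only [LinearMap.comp_apply, LinearMap.sub_apply] at h1 h2
  change p (s (π q)) = π q
  rw [h1, map_sub, h3, h2, sub_zero]

lemma ExtZ.pres (π : Q →ₗ[R] X) (hπ : Function.Surjective π)
    (h : ExtZ (ModuleCat.of R X) (ModuleCat.of R Y)) (φ : LinearMap.ker π →ₗ[R] Y) :
    ∃ ψ : Q →ₗ[R] Y, ψ.comp (LinearMap.ker π).subtype = φ :=
  h.extend (LinearMap.ker π).subtype π (Submodule.injective_subtype _) hπ (by simp) φ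

/-- A free presentation. -/
lemma exists_pres (X : Type u) [AddCommGroup X] [Module R X] [Module.Finite R X] :
    ∃ (n : ℕ) (π : (Fin n → R) →ₗ[R] X), Function.Surjective π :=
  Module.Finite.exists_fin' R X

/-- E2 -/
lemma ExtZ.ext [Module.Finite R X] (i : A →ₗ[R] M) (p : M →ₗ[R] C) (hi : Function.Injective i)
    (hp : Function.Surjective p)
    (h : LinearMap.ker p ≤ LinearMap.range i) (hA : ExtZ (ModuleCat.of R X) (ModuleCat.of R A))
    (hC : ExtZ (ModuleCat.of R X) (ModuleCat.of R C)) :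
    ExtZ (ModuleCat.of R X) (ModuleCat.of R M) := by
  obtain ⟨n, π, hπ⟩ := exists_pres (R := R) X
  refine ExtZ.of_pres π hπ (fun φ => ?_)
  obtain ⟨ψ, hψ⟩ := hC.pres π hπ (p.comp φ)
  obtain ⟨l, hl⟩ := Module.projective_lifting_property p ψ hp
  obtain ⟨φ', hφ'⟩ := cofactor i hi (φ - l.comp (LinearMap.ker π).subtype) (by
    rintro _ ⟨x, rfl⟩
    apply h
    have h1 := LinearMap.congr_fun hψ x
    have h2 := LinearMap.congr_fun hl (x : Fin n → R)
    simp only [LinearMap.comp_apply, Submodule.subtype_apply] at h1 h2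
    simp [h1, h2])
  obtain ⟨ψ', hψ'⟩ := hA.pres π hπ φ'
  refine ⟨l + i.comp ψ', ?_⟩
  rw [LinearMap.add_comp, LinearMap.comp_assoc, hψ', hφ']
  abel

/-- E3 -/
lemma ExtZ.lift [Module.Finite R X] (i : A →ₗ[R] M) (p : M →ₗ[R] C) (hi : Function.Injective i)
    (hp : Function.Surjective p) (h : LinearMap.range i = LinearMap.ker p)
    (hA : ExtZ (ModuleCat.of R X) (ModuleCat.of R A)) (f : X →ₗ[R] C) :
    ∃ g : X →ₗ[R] M, p.comp g = f := by
  obtain ⟨n, π, hπ⟩ := exists_pres (R := R) X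
  obtain ⟨l, hl⟩ := Module.projective_lifting_property p (f.comp π) hp
  obtain ⟨φ, hφ⟩ := cofactor i hi (l.comp (LinearMap.ker π).subtype) (by
    rw [h]
    rintro _ ⟨x, rfl⟩
    have := LinearMap.congr_fun hl (x : Fin n → R)
    simp only [LinearMap.comp_apply] at this
    have hx : π x = 0 := x.2
    simp [this])
  obtain ⟨ψ, hψ⟩ := hA.pres π hπ φ
  obtain ⟨s, hs⟩ := factor π hπ (l - i.comp ψ) (by
    intro x hx
    have h1 := LinearMap.congr_fun hφ ⟨x, hx⟩
    have h2 := LinearMap.congr_fun hψ ⟨x, hx⟩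
    simp only [LinearMap.comp_apply, Submodule.subtype_apply] at h1 h2
    simp [h2, h1])
  refine ⟨s, ?_⟩
  ext x
  obtain ⟨q, rfl⟩ := hπ x
  have h1 := LinearMap.congr_fun hs q
  have h2 := LinearMap.congr_fun hl q
  have h3 : p (i (ψ q)) = 0 := by
    have : i (ψ q) ∈ LinearMap.ker p := h ▸ ⟨ψ q, rfl⟩
    exact this
  simp only [LinearMap.comp_apply, LinearMap.sub_apply] at h1 h2 ⊢
  rw [h1, map_sub, h3, h2, sub_zero]

/-- E4 -/
lemma ExtZ.ker [Module.Finite R X] (f : N →ₗ[R] Z)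
    (hN : ExtZ (ModuleCat.of R X) (ModuleCat.of R N)) (hX : ∀ g : X →ₗ[R] Z, g = 0) :
    ExtZ (ModuleCat.of R X) (ModuleCat.of R (LinearMap.ker f)) := by
  obtain ⟨n, π, hπ⟩ := exists_pres (R := R) X
  refine ExtZ.of_pres π hπ (fun φ => ?_)
  obtain ⟨ψ, hψ⟩ := hN.pres π hπ ((LinearMap.ker f).subtype.comp φ)
  obtain ⟨s, hs⟩ := factor π hπ (f.comp ψ) (by
    intro x hx
    have h1 := LinearMap.congr_fun hψ ⟨x, hx⟩
    simp only [LinearMap.comp_apply, Submodule.subtype_apply] at h1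
    simp [h1])
  obtain ⟨ψ', hψ'⟩ := cofactor (LinearMap.ker f).subtype (Submodule.injective_subtype _) ψ (by
    rintro _ ⟨q, rfl⟩
    have h1 := LinearMap.congr_fun hs q
    rw [hX s] at h1
    simpa using h1.symm)
  refine ⟨ψ', ?_⟩
  ext x
  have h1 := LinearMap.congr_fun hψ x
  have h2 := LinearMap.congr_fun hψ' x
  simp only [LinearMap.comp_apply, Submodule.subtype_apply] at h1 h2 ⊢
  rw [h2, h1]

/-- Isomorphism invariance. -/
lemma ExtZ.iso (h : ExtZ (ModuleCat.of R X) (ModuleCat.of R Y)) (e : X ≃ₗ[R] A) (e' : Y ≃ₗ[R] B) :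
    ExtZ (ModuleCat.of R A) (ModuleCat.of R B) := by
  intro E i p hi hp hip
  change B →ₗ[R] E at i
  change E →ₗ[R] A at p
  obtain ⟨s, hs⟩ := h.split (i.comp e'.toLinearMap) (e.symm.toLinearMap.comp p)
    (by simpa using hi.comp e'.injective) (by simpa using e.symm.surjective.comp hp) (by
      rw [LinearMap.range_comp_of_range_eq_top _ (LinearEquiv.range e'), hip]
      exact (LinearMap.ker_comp_of_ker_eq_bot _ (LinearEquiv.ker e.symm)).symm)
  refine ⟨s.comp e.symm.toLinearMap, ?_⟩
  ext a
  have := LinearMap.congr_fun hs (e.symm a)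
  simp only [LinearMap.comp_apply, LinearMap.id_apply, LinearEquiv.coe_coe] at this
  exact e.symm.injective this

end

/-- Heredity, for finite modules, in terms of `Ext¹`. -/
structure HE (R : Type u) [Ring R] : Prop where
  quot : ∀ X Y Y' : ModuleCat.{u} R, Module.Finite R X → Module.Finite R Y →
    ∀ f : Y →ₗ[R] Y', Function.Surjective f → ExtZ X Y → ExtZ X Y'
  sub : ∀ X X' Y : ModuleCat.{u} R, Module.Finite R X → Module.Finite R Y →
    ∀ f : X' →ₗ[R] X, Function.Injective f → ExtZ X Y → ExtZ X' Y

lemma HE.of_her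
    (hher : ∀ P : ModuleCat.{u} R, Module.Projective R P →
      ∀ N : Submodule R P, Module.Projective R N) : HE R where
  quot X Y Y' hX hY f hf h := by
    obtain ⟨n, π, hπ⟩ := exists_pres (R := R) X
    have : Module.Projective R (LinearMap.ker π) :=
      hher (ModuleCat.of R (Fin n → R)) inferInstance (LinearMap.ker π)
    refine ExtZ.of_pres (X := X) (Y := Y') π hπ (fun φ => ?_)
    obtain ⟨φ', hφ'⟩ := Module.projective_lifting_property f φ hf
    obtain ⟨ψ, hψ⟩ := ExtZ.pres (X := X) (Y := Y) π hπ h φ'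
    exact ⟨f.comp ψ, by rw [LinearMap.comp_assoc, hψ, hφ']⟩
  sub X X' Y hX hY f hf h := by
    obtain ⟨n, π, hπ⟩ := exists_pres (R := R) X
    set Q' : Submodule R (Fin n → R) := (LinearMap.range f).comap π with hQ'
    have hQ'p : Module.Projective R Q' :=
      hher (ModuleCat.of R (Fin n → R)) inferInstance Q'
    obtain ⟨π', hπ'⟩ := cofactor f hf (π.comp Q'.subtype) (by
      rintro _ ⟨x, rfl⟩; exact x.2)
    have hπs : Function.Surjective π' := by
      intro x
      obtain ⟨q, hq⟩ := hπ (f x)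
      refine ⟨⟨q, ⟨x, hq.symm⟩⟩, hf ?_⟩
      exact (LinearMap.congr_fun hπ' _).trans hq
    have hker : ∀ x : LinearMap.ker π, (x : Fin n → R) ∈ Q' := by
      intro x
      refine ⟨0, ?_⟩
      have hx : π x = 0 := x.2
      rw [map_zero, hx]
    have hker' : ∀ x : LinearMap.ker π, (⟨x, hker x⟩ : Q') ∈ LinearMap.ker π' := by
      intro x
      apply hf
      have hx : π x = 0 := x.2
      rw [map_zero]
      exact (LinearMap.congr_fun hπ' _).trans hx
    refine ExtZ.of_pres (X := X') (Y := Y) π' hπs (fun φ => ?_)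
    set t : LinearMap.ker π →ₗ[R] LinearMap.ker π' :=
      ((LinearMap.ker π).subtype.codRestrict Q' hker).codRestrict _ hker' with ht
    obtain ⟨ψ, hψ⟩ := ExtZ.pres (X := X) (Y := Y) π hπ h (φ.comp t)
    refine ⟨ψ.comp Q'.subtype, ?_⟩
    ext x
    have hx : π (x : Q') = 0 := by
      have h1 := LinearMap.congr_fun hπ' (x : Q')
      have h2 : π' x = 0 := x.2
      simp only [LinearMap.comp_apply, Submodule.subtype_apply, h2, map_zero] at h1
      exact h1.symm
    exact LinearMap.congr_fun hψ ⟨(x : Q'), hx⟩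

section
variable {X Y Y' X' P : Type u} [AddCommGroup X] [Module R X] [AddCommGroup Y] [Module R Y]
  [AddCommGroup Y'] [Module R Y'] [AddCommGroup X'] [Module R X'] [AddCommGroup P] [Module R P]

lemma ExtZ.of_projective [Module.Projective R P] :
    ExtZ (ModuleCat.of R P) (ModuleCat.of R Y) := by
  intro E i p hi hp hip
  change E →ₗ[R] P at p
  exact Module.projective_lifting_property p LinearMap.id hp

lemma projective_of_ExtZ [IsNoetherianRing R] [Module.Finite R P]
    (h : ∀ Y : ModuleCat.{u} R, Module.Finite R Y → ExtZ (ModuleCat.of R P) Y) :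
    Module.Projective R P := by
  obtain ⟨n, π, hπ⟩ := exists_pres (R := R) P
  have hfin : Module.Finite R (LinearMap.ker π) := inferInstance
  obtain ⟨s, hs⟩ := (h (ModuleCat.of R (LinearMap.ker π)) hfin).split
    (LinearMap.ker π).subtype π (Submodule.injective_subtype _) hπ (by simp)
  exact Module.Projective.of_split s π hs

lemma HE.proj_sub [IsNoetherianRing R] (hH : HE R) [Module.Finite R P] [Module.Projective R P]
    (A : Submodule R P) : Module.Projective R A := by
  apply projective_of_ExtZ
  intro Y hY
  exact hH.sub (ModuleCat.of R P) (ModuleCat.of R A) Y ‹_› hY A.subtype A.injective_subtype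
    (ExtZ.of_projective (Y := Y))
end

end ExtLemmas

section PartOne

variable {R : Type u} [Ring R]

/-- Modules with vanishing `Ext¹(X, -)` form a torsion class. -/
lemma tors_ext [IsNoetherianRing R] (hH : HE R) (D : Set (ModuleCat.{u} R))
    (hD : ∀ X ∈ D, Module.Finite R X) :
    Tors {M : ModuleCat.{u} R | Module.Finite R M ∧ ∀ X ∈ D, ExtZ X M} where
  fin M hM := hM.1
  zero M hM := by
    refine ⟨tors_fin.zero M hM, fun X _ E i p hi hp hip => ?_⟩
    refine section_of_retraction (R := R) i p hp hip 0 ?_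
    ext x
    exact @Subsingleton.elim M hM _ _
  quot M N f hf hM := ⟨tors_fin.quot M N f hf hM.1,
    fun X hX => hH.quot X M N (hD X hX) hM.1 f hf (hM.2 X hX)⟩
  ext M A hA hC := by
    refine ⟨tors_fin.ext M A hA.1 hC.1, fun X hX => ?_⟩
    have : Module.Finite R X := hD X hX
    exact ExtZ.ext (X := X) (M := M) A.subtype A.mkQ A.injective_subtype A.mkQ_surjective
      (by simp) (hA.2 X hX) (hC.2 X hX)

lemma tors_proj (P : ModuleCat.{u} R) (hP : Module.Projective R P) :
    Tors {M : ModuleCat.{u} R | Module.Finite R M ∧ ∀ f : P →ₗ[R] M, f = 0} where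
  fin M hM := hM.1
  zero M hM := ⟨tors_fin.zero M hM, fun f => by ext x; exact @Subsingleton.elim M hM _ _⟩
  quot M N f hf hM := by
    refine ⟨tors_fin.quot M N f hf hM.1, fun g => ?_⟩
    obtain ⟨g', hg'⟩ := Module.projective_lifting_property f g hf
    rw [← hg', hM.2 g', LinearMap.comp_zero]
  ext M A hA hC := by
    refine ⟨tors_fin.ext M A hA.1 hC.1, fun g => ?_⟩
    have := RPerp.ext (M := M) (T := {P}) A.subtype A.mkQ A.injective_subtype (by simp)
      (fun X hX f => by cases hX; exact hA.2 f) (fun X hX f => by cases hX; exact hC.2 f)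
    exact this P rfl g

lemma tors_lperp (F : Set (ModuleCat.{u} R)) :
    Tors ({M : ModuleCat.{u} R | Module.Finite R M} ∩ LPerp F) :=
  tors_inter_lperp tors_fin F

/-- The tower lemma. -/
lemma tower (K : Type u) [Field K] [Algebra K R] [FiniteDimensional K R]
    (X : ModuleCat.{u} R) (hX : Module.Finite R X)
    (hXX : ExtZ X X) (PP : ModuleCat.{u} R → Prop)
    (hstep : ∀ (B B' : ModuleCat.{u} R) (i : B →ₗ[R] B') (p : B' →ₗ[R] X), PP B →
      Function.Injective i → Function.Surjective p → LinearMap.range i = LinearMap.ker p →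
      (¬ ∃ s : X →ₗ[R] B', p.comp s = LinearMap.id) → PP B')
    (B0 : ModuleCat.{u} R) (hB0 : Module.Finite R B0) (h0 : PP B0) :
    ∃ B : ModuleCat.{u} R, PP B ∧ ExtZ X B := by
  obtain ⟨n, π, hπ⟩ := exists_pres (R := R) X
  let _ : Module K B0 := Module.compHom B0 (algebraMap K R)
  have : IsScalarTower K R B0 := ⟨fun c r b => by
    rw [Algebra.smul_def, mul_smul]; rfl⟩
  have : Module.Finite K B0 := Module.Finite.trans R B0
  have : IsNoetherianRing R := IsNoetherianRing.of_finite K R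
  have : Module.Finite R (LinearMap.ker π) := inferInstance
  have : Module.Finite K (LinearMap.ker π) := Module.Finite.trans R _
  have hnoeth : IsNoetherian K (LinearMap.ker π →ₗ[R] B0) := by
    refine isNoetherian_of_injective (LinearMap.restrictScalarsₗ K R (LinearMap.ker π) B0 K) ?_
    exact LinearMap.restrictScalars_injective K
  let Sub : ∀ (B : ModuleCat.{u} R) (j : B0 →ₗ[R] B), Submodule K (LinearMap.ker π →ₗ[R] B0) :=
    fun B j =>
    { carrier := {φ | ∃ ψ : (Fin n → R) →ₗ[R] B, ψ.comp (LinearMap.ker π).subtype = j.comp φ}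
      add_mem' := by
        rintro a b ⟨ψ, hψ⟩ ⟨ψ', hψ'⟩
        exact ⟨ψ + ψ', by rw [LinearMap.add_comp, hψ, hψ', LinearMap.comp_add]⟩
      zero_mem' := ⟨0, by simp⟩
      smul_mem' := by
        rintro c φ ⟨ψ, hψ⟩
        refine ⟨ψ.comp (c • LinearMap.id), ?_⟩
        ext w
        have h1 := LinearMap.congr_fun hψ (c • w)
        simp only [LinearMap.comp_apply, Submodule.subtype_apply] at h1
        have h2 : φ (c • w) = c • φ w := LinearMap.map_smul_of_tower φ c w
        rw [h2] at h1
        exact h1 }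
  obtain ⟨S, ⟨B, j, hPB, hinv, rfl⟩, hmax⟩ :=
    (wellFounded_gt (α := Submodule K (LinearMap.ker π →ₗ[R] B0))).has_min
    {S | ∃ (B : ModuleCat.{u} R) (j : B0 →ₗ[R] B), PP B ∧
      (∀ ξ : LinearMap.ker π →ₗ[R] B, ∃ (φ : LinearMap.ker π →ₗ[R] B0)
        (ψ : (Fin n → R) →ₗ[R] B), ξ = j.comp φ + ψ.comp (LinearMap.ker π).subtype) ∧
      S = Sub B j} ⟨_, B0, LinearMap.id, h0, fun ξ => ⟨ξ, 0, by simp⟩, rfl⟩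
  refine ⟨B, hPB, ?_⟩
  by_cases htop : ∀ φ, φ ∈ Sub B j
  · refine ExtZ.of_pres (X := X) (Y := B) π hπ (fun ξ => ?_)
    obtain ⟨φ, ψ, hξ⟩ := hinv ξ
    obtain ⟨ψ', hψ'⟩ := htop φ
    exact ⟨ψ' + ψ, by rw [LinearMap.add_comp, hψ', hξ]⟩
  · exfalso
    push Not at htop
    obtain ⟨φ, hφ⟩ := htop
    obtain ⟨B', i', p', h, hi', hp', hip', h1, h2⟩ := pushout (LinearMap.ker π).subtype π
      (Submodule.injective_subtype _) hπ (by simp) (j.comp φ)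
    have hPB' : PP B' := by
      refine hstep B B' i' p' hPB hi' hp' hip' ?_
      rintro ⟨s, hs⟩
      obtain ⟨r, hr⟩ := retraction_of_section (R := R) i' p' hi' hip' s hs
      refine hφ ⟨r.comp h, ?_⟩
      rw [LinearMap.comp_assoc, h1, ← LinearMap.comp_assoc, hr, LinearMap.id_comp]
    refine hmax (Sub B' (i'.comp j)) ⟨B', i'.comp j, hPB', ?_, rfl⟩ ?_
    · intro ξ
      obtain ⟨ψ, hψ⟩ := ExtZ.pres (X := X) (Y := X) π hπ hXX (p'.comp ξ)
      obtain ⟨l, hl⟩ := Module.projective_lifting_property p' ψ hp'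
      obtain ⟨ξ', hξ'⟩ := cofactor i' hi' (ξ - l.comp (LinearMap.ker π).subtype) (by
        rw [hip']
        rintro _ ⟨x, rfl⟩
        have h1 := LinearMap.congr_fun hψ x
        have h2 := LinearMap.congr_fun hl (x : Fin n → R)
        simp only [LinearMap.comp_apply, Submodule.subtype_apply] at h1 h2
        simp [h1, h2])
      obtain ⟨φ', ψ', hφ'⟩ := hinv ξ'
      refine ⟨φ', i'.comp ψ' + l, ?_⟩
      have : ξ = i'.comp ξ' + l.comp (LinearMap.ker π).subtype := by rw [hξ']; abel
      rw [this, hφ', LinearMap.comp_add, LinearMap.add_comp, LinearMap.comp_assoc,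
        LinearMap.comp_assoc, add_assoc]
    · refine lt_of_le_of_ne ?_ ?_
      · rintro φ' ⟨ψ, hψ⟩
        exact ⟨i'.comp ψ, by rw [LinearMap.comp_assoc, hψ, LinearMap.comp_assoc]⟩
      · intro heq
        apply hφ
        rw [heq]
        exact ⟨h, by rw [h1, LinearMap.comp_assoc]⟩

variable [IsArtinianRing R] [Finite (TorsC R)]

lemma part_one_mp (hH : HE R) (T' : TorsC R) (T : Set (ModuleCat.{u} R)) (hT : T = Pop T'.1) :
    (∀ X ∈ DS T, ∀ X' ∈ DS T, ExtZ X X') ∧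
    ∀ P ∈ T, Module.Projective R P → Subsingleton P := by
  have hTT : Tors T := by rw [hT]; exact tors_inter_lperp T'.2 _
  have hle : T ⊆ T'.1 := by rw [hT]; exact fun M hM => hM.1
  have hV : ∀ V ∈ DS T'.1, V ∈ RPerp T := by
    intro V hV Y hY f
    rw [hT] at hY
    exact hY.2 V hV f
  refine ⟨?_, ?_⟩
  · intro X hX X' hX'
    have key : ∀ V ∈ DS T'.1, ExtZ X V := by
      intro V hVD E i p hi hp hip
      have hET' : E ∈ T'.1 := T'.2.ext' (M := E) i p hp hip.ge hVD.1.1 (hle hX.1.1)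
      have hET : E ∉ T := by
        intro hE
        have h1 : ModuleCat.of R (LinearMap.ker p) ∈ T := hX.1.2 E hE p
        obtain ⟨j, hj⟩ := cofactor i hi (LinearMap.ker p).subtype (by simp [hip])
        have h2 := RPerp.zero' (hV V hVD) h1 j
        obtain ⟨m, hm⟩ := hVD.2.1
        apply hm
        have hmem : i m ∈ LinearMap.ker p := hip ▸ ⟨m, rfl⟩
        have h3 := LinearMap.congr_fun hj ⟨i m, hmem⟩
        rw [h2] at h3
        apply hi
        rw [map_zero]
        simpa using h3.symm
      have hg : ∃ X'' ∈ DS T'.1, ∃ g : E →ₗ[R] X'', g ≠ 0 := by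
        by_contra hcon
        push Not at hcon
        apply hET
        rw [hT]
        exact ⟨hET', hcon⟩
      obtain ⟨X'', hX'', g, hg⟩ := hg
      have hgi : g.comp i ≠ 0 := by
        intro h0
        obtain ⟨ψ, hψ⟩ := factor p hp g (by
          rw [← hip]
          rintro _ ⟨v, rfl⟩
          exact LinearMap.congr_fun h0 v)
        apply hg
        rw [← hψ, hV X'' hX'' X hX.1.1 ψ, LinearMap.zero_comp]
      have hb := DS.bij T'.2 hX'' hVD (g.comp i) hgi
      set e := LinearEquiv.ofBijective (g.comp i) hb with he
      refine section_of_retraction (R := R) i p hp hip (e.symm.toLinearMap.comp g) ?_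
      ext v
      exact e.symm_apply_apply v
    have hXf : Module.Finite R X := hTT.fin X hX.1.1
    have := le_of_DS T' ⟨_, tors_ext hH {X} (by rintro _ rfl; exact hXf)⟩
      (fun V hV => ⟨T'.2.fin V hV.1.1, by rintro _ rfl; exact key V hV⟩)
    exact (this (hle hX'.1.1)).2 X rfl
  · intro P hP hPp
    have := le_of_DS T' ⟨_, tors_proj P hPp⟩
      (fun V hVD => ⟨T'.2.fin V hVD.1.1, fun f => hV V hVD P hP f⟩)
    exact subsing_of_id ((this (hle hP)).2 LinearMap.id)

/-- The `B`-lemma. -/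
lemma blemma (K : Type u) [Field K] [Algebra K R] [FiniteDimensional K R] (T : TorsC R)
    (hE : ∀ X ∈ DS T.1, ∀ M ∈ T.1, ExtZ X M)
    (hP : ∀ P : ModuleCat.{u} R, Module.Finite R P → Module.Projective R P → P ∈ RPerp T.1)
    (M : ModuleCat.{u} R) (hM : M ∈ T.1) :
    ∃ B : ModuleCat.{u} R, Module.Finite R B ∧ B ∈ RPerp T.1 ∧ (∀ X ∈ DS T.1, ExtZ X B) ∧
      ∃ f : B →ₗ[R] M, Function.Surjective f := by
  have hMf : Module.Finite R M := T.2.fin M hM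
  obtain ⟨n, π, hπ⟩ := exists_pres (R := R) M
  let PP : Set (TorsC R) → ModuleCat.{u} R → Prop := fun 𝒮 B =>
    Module.Finite R B ∧ B ∈ RPerp T.1 ∧
    (∃ j : (Fin n → R) →ₗ[R] B, ∀ M' ∈ T.1, ∀ φ : (Fin n → R) →ₗ[R] M',
      ∃ ψ : B →ₗ[R] M', ψ.comp j = φ) ∧
    ∀ X ∈ DS T.1, (⟨Cut T.1 X, tors_cut T.2 X⟩ : TorsC R) ∈ 𝒮 → ExtZ X B
  have main : ∀ 𝒮 : Set (TorsC R), ∃ B, PP 𝒮 B := by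
    intro 𝒮
    induction 𝒮, 𝒮.toFinite using Set.Finite.induction_on with
    | empty =>
      exact ⟨ModuleCat.of R (Fin n → R), inferInstanceAs (Module.Finite R (Fin n → R)),
        hP _ (inferInstanceAs (Module.Finite R (Fin n → R)))
          (inferInstanceAs (Module.Projective R (Fin n → R))),
        ⟨LinearMap.id, fun M' _ φ => ⟨φ, rfl⟩⟩, fun X _ h => absurd h (Set.notMem_empty _)⟩
    | @insert c 𝒮 _ _ ih =>
      obtain ⟨B0, hB0⟩ := ih
      by_cases hc : ∃ X ∈ DS T.1, (⟨Cut T.1 X, tors_cut T.2 X⟩ : TorsC R) = c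
      · obtain ⟨X, hX, hXc⟩ := hc
        have hXf : Module.Finite R X := T.2.fin X hX.1.1
        obtain ⟨B, hB, hBX⟩ := tower K X hXf (hE X hX X hX.1.1) (PP 𝒮) (by
          rintro B B' i p ⟨hBf, hBT, ⟨j, hj⟩, hBE⟩ hi hp hip hns
          refine ⟨?_, ?_, ⟨i.comp j, ?_⟩, ?_⟩
          · exact tors_fin.ext' (M := B') i p hp hip.ge hBf hXf
          · intro Y hY g
            rcases DS.zero_or_surj T.2 hX hY (p.comp g) with h | h
            · obtain ⟨g', hg'⟩ := cofactor i hi g (by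
                rw [hip]
                rintro _ ⟨y, rfl⟩
                exact LinearMap.congr_fun h y)
              rw [← hg', hBT Y hY g', LinearMap.comp_zero]
            · exfalso
              have hk : ModuleCat.of R (LinearMap.ker (p.comp g)) ∈ T.1 := hX.1.2 Y hY _
              obtain ⟨g', hg'⟩ := cofactor i hi (g.comp (LinearMap.ker (p.comp g)).subtype) (by
                rw [hip]
                rintro _ ⟨y, rfl⟩
                exact y.2)
              have h0 : g' = 0 := RPerp.zero' hBT hk g'
              obtain ⟨s, hs⟩ := factor (p.comp g) h g (by
                intro y hy
                have := LinearMap.congr_fun hg' ⟨y, hy⟩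
                rw [h0] at this
                simpa using this.symm)
              apply hns
              refine ⟨s, ?_⟩
              ext x
              obtain ⟨y, rfl⟩ := h x
              have := LinearMap.congr_fun hs y
              simp only [LinearMap.comp_apply] at this
              simp [this]
          · intro M' hM' φ
            obtain ⟨ψ, hψ⟩ := hj M' hM' φ
            obtain ⟨ψ', hψ'⟩ := ExtZ.extend (C := X) (M := M') (hE X hX M' hM') i p hi hp hip ψ
            exact ⟨ψ', by rw [← LinearMap.comp_assoc, hψ', hψ]⟩
          · intro X' hX' hX'S
            have hXf' : Module.Finite R X' := T.2.fin X' hX'.1.1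
            exact ExtZ.ext (X := X') (M := B') i p hi hp hip.ge (hBE X' hX' hX'S)
              (hE X' hX' X hX.1.1)) B0 hB0.1 hB0
        refine ⟨B, hB.1, hB.2.1, hB.2.2.1, ?_⟩
        rintro X' hX' (h | h)
        · have hne : ∃ f : X' →ₗ[R] X, f ≠ 0 := by
            by_contra hcon
            push Not at hcon
            have h1 : X' ∈ Cut T.1 X := ⟨hX'.1.1, hcon⟩
            have h2 : Cut T.1 X = Cut T.1 X' := congrArg Subtype.val (hXc.trans h.symm)
            rw [h2] at h1
            exact DS.ne_zero hX' (subsing_of_id (h1.2 LinearMap.id))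
          obtain ⟨f, hf⟩ := hne
          exact ExtZ.iso (X := X) (Y := B) (A := X') (B := B) hBX
            (LinearEquiv.ofBijective f (DS.bij T.2 hX hX' f hf)).symm (LinearEquiv.refl R B)
        · exact hB.2.2.2 X' hX' h
      · refine ⟨B0, hB0.1, hB0.2.1, hB0.2.2.1, ?_⟩
        rintro X' hX' (h | h)
        · exact absurd ⟨X', hX', h⟩ hc
        · exact hB0.2.2.2 X' hX' h
  obtain ⟨B, h1, h2, ⟨j, hj⟩, h4⟩ := main Set.univ
  obtain ⟨ψ, hψ⟩ := hj M hM π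
  refine ⟨B, h1, h2, fun X hX => h4 X hX (Set.mem_univ _), ψ, ?_⟩
  intro m
  obtain ⟨q, rfl⟩ := hπ m
  exact ⟨j q, LinearMap.congr_fun hψ q⟩

lemma part_one_mpr (K : Type u) [Field K] [Algebra K R] [FiniteDimensional K R] (hH : HE R)
    (T : TorsC R) (h1 : ∀ X ∈ DS T.1, ∀ X' ∈ DS T.1, ExtZ X X')
    (h2 : ∀ P ∈ T.1, Module.Projective R P → Subsingleton P) :
    ∃ T' : TorsC R, T.1 = Pop T'.1 := by
  have hDf : ∀ X ∈ DS T.1, Module.Finite R X := fun X hX => T.2.fin X hX.1.1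
  let T' : TorsC R := ⟨_, tors_ext hH (DS T.1) hDf⟩
  have hle : T ≤ T' := le_of_DS T T' (fun X hX => ⟨hDf X hX, fun Y hY => h1 Y hY X hX⟩)
  have hE : ∀ X ∈ DS T.1, ∀ M ∈ T.1, ExtZ X M := fun X hX M hM => (hle hM).2 X hX
  have hP : ∀ P : ModuleCat.{u} R, Module.Finite R P → Module.Projective R P →
      P ∈ RPerp T.1 := by
    intro P hPf hPp Y hY f
    have h3 : Subsingleton (LinearMap.range f) :=
      h2 _ (T.2.range f hY) (hH.proj_sub (LinearMap.range f))
    rw [Submodule.subsingleton_iff_eq_bot] at h3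
    exact LinearMap.range_eq_bot.1 h3
  -- Hom-vanishing from bricks extends to all of `T`
  have hHom : ∀ Z : ModuleCat.{u} R, (∀ X ∈ DS T.1, ∀ f : X →ₗ[R] Z, f = 0) →
      Z ∈ RPerp T.1 := by
    intro Z hZ M hM f
    have := le_of_DS T ⟨_, tors_lperp {Z}⟩
      (fun X hX => ⟨hDf X hX, by rintro _ rfl f; exact hZ X hX f⟩)
    exact (this hM).2 Z rfl f
  refine ⟨T', Set.Subset.antisymm ?_ ?_⟩
  · intro M hM
    refine ⟨hle hM, fun X' hX' f => ?_⟩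
    by_contra hf
    have hs := (DS.zero_or_surj T'.2 hX' (hle hM) f).resolve_left hf
    have hX'T : X' ∈ T.1 := T.2.quot M X' f hs hM
    obtain ⟨B, hBf, hBT, hBE, b, hb⟩ := blemma K T hE hP X' hX'T
    have hk : ModuleCat.of R (LinearMap.ker b) ∈ T'.1 := hX'.1.2 B ⟨hBf, hBE⟩ b
    have hperp : X' ∈ RPerp T.1 := by
      apply hHom
      intro X hX g
      have := hDf X hX
      obtain ⟨g', hg'⟩ := ExtZ.lift (X := X) (M := B) (LinearMap.ker b).subtype b
        (Submodule.injective_subtype _) hb (by simp) (hk.2 X hX) g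
      rw [← hg', hBT X hX.1.1 g', LinearMap.comp_zero]
    exact DS.ne_zero hX' (RPerp.inter hperp hX'T)
  · have claim : ∀ n : ℕ, ∀ Z : ModuleCat.{u} R, len R Z = n → Z ∈ T'.1 → Z ∈ RPerp T.1 →
        ¬ Subsingleton Z → ∃ X ∈ DS T'.1, ∃ g : Z →ₗ[R] X, g ≠ 0 := by
      intro n
      induction n using Nat.strong_induction_on with
      | _ n ih =>
        intro Z hn hZ hZT hZ0
        have hZf : Module.Finite R Z := T'.2.fin Z hZ
        have hW : Z ∈ WL T'.1 := by
          refine ⟨hZ, fun N hN f => ⟨?_, fun X hX => ?_⟩⟩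
          · have : Module.Finite R N := T'.2.fin N hN
            exact (inferInstance : Module.Finite R (LinearMap.ker f))
          · have := hDf X hX
            exact ExtZ.ker (X := X) f (hN.2 X hX) (fun g => hZT X hX.1.1 g)
        by_cases hD : Z ∈ DS T'.1
        · refine ⟨Z, hD, LinearMap.id, fun h => hZ0 (subsing_of_id h)⟩
        · have hex : ∃ N : Submodule R Z, ModuleCat.of R N ∈ WL T'.1 ∧ N ≠ ⊥ ∧ N ≠ ⊤ := by
            by_contra hcon
            push Not at hcon
            apply hD
            refine ⟨hW, ?_, fun N hN => ?_⟩
            · by_contra hc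
              push Not at hc
              exact hZ0 ⟨fun a b => by rw [hc a, hc b]⟩
            · by_cases hN0 : N = ⊥
              · exact Or.inl hN0
              · exact Or.inr (hcon N hN hN0)
          obtain ⟨N, hN, hN0, hN1⟩ := hex
          have hq : ModuleCat.of R (Z ⧸ N) ∈ T'.1 := T'.2.quot' (M := Z) N.mkQ N.mkQ_surjective hZ
          have hqT : ModuleCat.of R (Z ⧸ N) ∈ RPerp T.1 := by
            apply hHom
            intro X hX g
            have := hDf X hX
            obtain ⟨g', hg'⟩ := ExtZ.lift (X := X) (M := Z) N.subtype N.mkQ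
              N.injective_subtype N.mkQ_surjective (by simp) (hN.1.2 X hX) g
            rw [← hg', hZT X hX.1.1 g', LinearMap.comp_zero]
          obtain ⟨X, hX, g, hg⟩ := ih _ (hn ▸ len_lt_quot hN0) (ModuleCat.of R (Z ⧸ N)) rfl hq hqT
            (fun h => hN1 (Submodule.Quotient.subsingleton_iff.1 h))
          refine ⟨X, hX, LinearMap.comp g N.mkQ, fun h => hg ?_⟩
          ext z
          exact LinearMap.congr_fun h z
    intro M hM
    have hMf : Module.Finite R M := T'.2.fin M hM.1
    obtain ⟨A, hA, hA'⟩ := radical (M := M) T.2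
    by_cases hs : Subsingleton (M ⧸ A)
    · exact T.2.ext M A hA (T.2.zero _ hs)
    · exfalso
      obtain ⟨X, hX, g, hg⟩ := claim _ (ModuleCat.of R (M ⧸ A)) rfl
        (T'.2.quot' (M := M) A.mkQ A.mkQ_surjective hM.1) hA' hs
      apply hg
      have h3 := hM.2 X hX (LinearMap.comp g A.mkQ)
      ext z
      exact LinearMap.congr_fun h3 z

end PartOne

section Duality

/-- Anti-homomorphisms of algebras. -/
class Anti (K R S : Type u) [Field K] [Ring R] [Ring S] [Algebra K R] [Algebra K S] where
  a : S → R
  a_add : ∀ x y, a (x + y) = a x + a y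
  a_mul : ∀ x y, a (x * y) = a y * a x
  a_alg : ∀ c : K, a (algebraMap K S c) = algebraMap K R c

/-- Mutually inverse anti-homomorphisms of algebras. -/
class AntiInv (K R S : Type u) [Field K] [Ring R] [Ring S] [Algebra K R] [Algebra K S]
    [Anti K R S] [Anti K S R] : Prop where
  inv : ∀ r : R, Anti.a K (R := R) (S := S) (Anti.a K (R := S) (S := R) r) = r

/-- The additive group of `K`-linear functionals on an `R`-module. -/
def DuSub (K R M : Type u) [Field K] [Ring R] [Algebra K R] [AddCommGroup M] [Module R M] :
    AddSubgroup (M →+ K) where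
  carrier := {f | ∀ (c : K) (m : M), f (algebraMap K R c • m) = c * f m}
  add_mem' := by
    intro f g hf hg c m
    simp only [Set.mem_setOf_eq] at hf hg
    simp [hf, hg, mul_add]
  zero_mem' := by intro c m; simp
  neg_mem' := by
    intro f hf c m
    simp only [Set.mem_setOf_eq] at hf
    simp [hf]

/-- The `K`-dual of an `R`-module, viewed as a module over the opposite ring `S`. -/
def Du (K R : Type u) (_S : Type u) (M : Type u) [Field K] [Ring R] [Algebra K R]
    [AddCommGroup M] [Module R M] : Type u := DuSub K R M

section
variable {K R S M N : Type u} [Field K] [Ring R] [Algebra K R] [Ring S] [Algebra K S]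
  [AddCommGroup M] [Module R M] [AddCommGroup N] [Module R N]

instance : AddCommGroup (Du K R S M) := inferInstanceAs (AddCommGroup (DuSub K R M))

instance : CoeFun (Du K R S M) (fun _ => M → K) := ⟨fun f => f.1⟩

lemma Du.ext {f g : Du K R S M} (h : ∀ m, f m = g m) : f = g :=
  Subtype.ext (AddMonoidHom.ext h)

lemma Du.add_apply (f g : Du K R S M) (m : M) : (f + g) m = f m + g m := rfl
lemma Du.zero_apply (m : M) : (0 : Du K R S M) m = 0 := rfl
lemma Du.map_alg (f : Du K R S M) (c : K) (m : M) : f (algebraMap K R c • m) = c * f m := f.2 c m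
lemma Du.map_add (f : Du K R S M) (m n : M) : f (m + n) = f m + f n := f.1.map_add m n
lemma Du.map_zero (f : Du K R S M) : f 0 = 0 := f.1.map_zero

/-- Build an element of the dual. -/
def Du.mk (S : Type u) (f : M → K) (h : ∀ m n, f (m + n) = f m + f n)
    (h' : ∀ (c : K) m, f (algebraMap K R c • m) = c * f m) : Du K R S M :=
  ⟨AddMonoidHom.mk' f h, h'⟩

lemma Du.mk_apply (f : M → K) (h h') (m : M) : (Du.mk (R := R) S f h h') m = f m := rfl

variable [Anti K R S]

instance : SMul S (Du K R S M) := ⟨fun s f =>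
  Du.mk S (fun m => f (Anti.a K (R := R) s • m)) (fun m n => by rw [smul_add, f.map_add])
    (fun c m => by
      rw [← mul_smul, ← Algebra.commutes, mul_smul, f.map_alg])⟩

lemma Du.smul_apply (s : S) (f : Du K R S M) (m : M) :
    (s • f) m = f (Anti.a K (R := R) s • m) := rfl

instance : Module S (Du K R S M) where
  one_smul f := Du.ext fun m => by
    rw [Du.smul_apply, ← map_one (algebraMap K S), Anti.a_alg, map_one, one_smul]
  mul_smul x y f := Du.ext fun m => by
    rw [Du.smul_apply, Du.smul_apply, Du.smul_apply, Anti.a_mul, mul_smul]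
  smul_zero x := Du.ext fun m => rfl
  smul_add x f g := Du.ext fun m => rfl
  add_smul x y f := Du.ext fun m => by
    rw [Du.smul_apply, Anti.a_add, add_smul, Du.map_add]; rfl
  zero_smul f := Du.ext fun m => by
    rw [Du.smul_apply, ← map_zero (algebraMap K S), Anti.a_alg, map_zero, zero_smul, Du.map_zero]
    rfl

/-- Functoriality of the dual. -/
def Dmap (K S : Type u) [Field K] [Algebra K R] [Ring S] [Algebra K S] [Anti K R S]
    (f : M →ₗ[R] N) : Du K R S N →ₗ[S] Du K R S M where
  toFun g := Du.mk S (fun m => g (f m)) (fun m n => by rw [_root_.map_add, g.map_add])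
    (fun c m => by rw [map_smul, g.map_alg])
  map_add' g h := rfl
  map_smul' s g := Du.ext fun m => by
    rw [Du.mk_apply, Du.smul_apply, RingHom.id_apply, Du.smul_apply, Du.mk_apply, f.map_smul]

lemma Dmap_apply (f : M →ₗ[R] N) (g : Du K R S N) (m : M) : (Dmap K S f g) m = g (f m) := rfl

end

section
variable {K R S M N A B C : Type u} [Field K] [Ring R] [Algebra K R] [Ring S] [Algebra K S]
  [AddCommGroup M] [Module R M] [AddCommGroup N] [Module S N]
  [AddCommGroup A] [Module R A] [AddCommGroup B] [Module R B] [AddCommGroup C] [Module R C]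
  [Anti K R S]

/-- Separation of points. -/
lemma Du.sep (S : Type u) {m : M} (h : ∀ f : Du K R S M, f m = 0) : m = 0 := by
  let _ : Module K M := Module.compHom M (algebraMap K R)
  refine (Module.forall_dual_apply_eq_zero_iff K m).1 (fun φ => ?_)
  exact h (Du.mk S φ (fun m n => _root_.map_add φ m n) (fun c m => φ.map_smul c m))

/-- Extension of functionals. -/
lemma Du.extend (i : A →ₗ[R] B) (hi : Function.Injective i) (f : Du K R S A) :
    ∃ g : Du K R S B, ∀ x, g (i x) = f x := by
  let _ : Module K A := Module.compHom A (algebraMap K R)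
  let _ : Module K B := Module.compHom B (algebraMap K R)
  let iK : A →ₗ[K] B :=
    { toFun := i, map_add' := fun x y => _root_.map_add i x y,
      map_smul' := fun c x => i.map_smul (algebraMap K R c) x }
  let fK : A →ₗ[K] K :=
    { toFun := f, map_add' := f.map_add, map_smul' := f.map_alg }
  obtain ⟨r, hr⟩ := iK.exists_leftInverse_of_injective (LinearMap.ker_eq_bot.2 hi)
  refine ⟨Du.mk S (fun b => fK (r b)) (fun m n => by simp)
    (fun c m => by
      have : r (algebraMap K R c • m) = c • r m := r.map_smul c m
      rw [this, _root_.map_smul]; rfl), fun x => ?_⟩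
  have : r (i x) = x := LinearMap.congr_fun hr x
  rw [Du.mk_apply, this]; rfl

lemma Dmap_surj {i : A →ₗ[R] B} (hi : Function.Injective i) :
    Function.Surjective (Dmap K S i) := fun f => by
  obtain ⟨g, hg⟩ := Du.extend i hi f
  exact ⟨g, Du.ext hg⟩

lemma Dmap_inj {p : A →ₗ[R] B} (hp : Function.Surjective p) :
    Function.Injective (Dmap K S p) := fun f g h => Du.ext fun b => by
  obtain ⟨a, rfl⟩ := hp b
  exact congrArg (fun φ : Du K R S A => φ a) h

/-- Exactness of the dual at the middle. -/
lemma Dmap_exact (i : A →ₗ[R] B) (p : B →ₗ[R] C) (h : LinearMap.ker p ≤ LinearMap.range i) :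
    LinearMap.ker (Dmap K S i) ≤ LinearMap.range (Dmap K S p) := by
  intro g hg
  have hg' : ∀ x, g (i x) = 0 := fun x => congrArg (fun φ : Du K R S A => φ x) hg
  have hk : ∀ x y, p x = p y → g x = g y := by
    intro x y hxy
    have : x - y ∈ LinearMap.ker p := by simp [hxy]
    obtain ⟨a, ha⟩ := h this
    have h1 : x = i a + y := by rw [ha]; abel
    rw [h1, g.map_add, hg', zero_add]
  choose t ht using fun y : LinearMap.range p => y.2
  let q : Du K R S (LinearMap.range p) := Du.mk S (fun y => g (t y))
    (fun m n => by
      rw [← g.map_add]; apply hk; rw [_root_.map_add, ht, ht, ht]; rfl)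
    (fun c m => by
      rw [← g.map_alg]; apply hk; rw [_root_.map_smul, ht, ht]; rfl)
  obtain ⟨q', hq'⟩ := Du.extend (LinearMap.range p).subtype (Submodule.injective_subtype _) q
  refine ⟨q', Du.ext fun b => ?_⟩
  have := hq' ⟨p b, ⟨b, rfl⟩⟩
  rw [Dmap_apply]
  refine this.trans ?_
  exact hk _ _ (ht _)

lemma Du.subsing (h : Subsingleton (Du K R S M)) : Subsingleton M :=
  ⟨fun a b => by
    rw [Du.sep (K := K) (R := R) S (m := a) (fun f => by rw [h.elim f 0]; rfl),
      Du.sep (K := K) (R := R) S (m := b) (fun f => by rw [h.elim f 0]; rfl)]⟩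

lemma Du.subsing' [h : Subsingleton M] : Subsingleton (Du K R S M) :=
  ⟨fun f g => Du.ext fun m => by rw [h.elim m 0, f.map_zero, g.map_zero]⟩

lemma inj_of_Dmap_surj {i : A →ₗ[R] B} (h : Function.Surjective (Dmap K S i)) :
    Function.Injective i := by
  rw [← LinearMap.ker_eq_bot, LinearMap.ker_eq_bot']
  intro x hx
  refine Du.sep (K := K) (R := R) S (fun f => ?_)
  obtain ⟨g, rfl⟩ := h f
  rw [Dmap_apply, hx, g.map_zero]

lemma surj_of_Dmap_inj {p : A →ₗ[R] B} (h : Function.Injective (Dmap K S p)) :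
    Function.Surjective p := by
  rw [← LinearMap.range_eq_top, ← Submodule.Quotient.subsingleton_iff]
  refine Du.subsing (K := K) (R := R) (S := S) ⟨fun f g => ?_⟩
  apply Dmap_inj (K := K) (S := S) (LinearMap.range p).mkQ_surjective
  apply h
  refine Du.ext fun x => ?_
  have hx : (LinearMap.range p).mkQ (p x) = 0 := by simp
  rw [Dmap_apply, Dmap_apply, Dmap_apply, Dmap_apply, hx, f.map_zero, g.map_zero]

lemma eq_zero_of_Dmap {f : A →ₗ[R] B} (h : Dmap K S f = 0) : f = 0 := by
  ext x
  refine Du.sep (K := K) (R := R) S (fun g => ?_)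
  exact congrArg (fun φ : Du K R S A => φ x) (LinearMap.congr_fun h g)

/-- Finiteness of the dual. -/
lemma Du.finite [FiniteDimensional K R] [Module.Finite R M] : Module.Finite S (Du K R S M) := by
  let _ : Module K M := Module.compHom M (algebraMap K R)
  have : IsScalarTower K R M := ⟨fun c r b => by rw [Algebra.smul_def, mul_smul]; rfl⟩
  have : Module.Finite K M := Module.Finite.trans R M
  let _ : Module K (Du K R S M) := Module.compHom _ (algebraMap K S)
  have : IsScalarTower K S (Du K R S M) := ⟨fun c r b => by
    rw [Algebra.smul_def, mul_smul]; rfl⟩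
  let t : Du K R S M →ₗ[K] Module.Dual K M :=
    { toFun := fun f => { toFun := f, map_add' := f.map_add, map_smul' := f.map_alg }
      map_add' := fun f g => rfl
      map_smul' := fun c f => by
        ext m
        change f (Anti.a K (R := R) (algebraMap K S c) • m) = c * f m
        rw [Anti.a_alg, f.map_alg] }
  have ht : Function.Injective t := fun f g h => Du.ext fun m => LinearMap.congr_fun h m
  have : Module.Finite K (Du K R S M) := Module.Finite.of_injective t ht
  exact Module.Finite.of_restrictScalars_finite K S _

variable [Anti K S R] [AntiInv K R S]

/-- Transposition. -/
def flip (f : N →ₗ[S] Du K R S M) : M →ₗ[R] Du K S R N where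
  toFun m := Du.mk R (fun n => f n m) (fun x y => by rw [_root_.map_add]; rfl)
    (fun c n => by rw [map_smul, Du.smul_apply, Anti.a_alg, Du.map_alg])
  map_add' x y := Du.ext fun n => (f n).map_add x y
  map_smul' r x := Du.ext fun n => by
    rw [Du.mk_apply, RingHom.id_apply, Du.smul_apply, Du.mk_apply, f.map_smul, Du.smul_apply,
      AntiInv.inv]

lemma flip_apply (f : N →ₗ[S] Du K R S M) (m : M) (n : N) : (flip f m) n = f n m := rfl

lemma flip_eq_zero {f : N →ₗ[S] Du K R S M} (h : flip f = 0) : f = 0 := by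
  ext n
  exact Du.ext fun m => congrArg (fun φ : Du K S R N => φ n) (LinearMap.congr_fun h m)

/-- Evaluation. -/
def ev (K S : Type u) [Field K] [Algebra K R] [Ring S] [Algebra K S] [Anti K R S]
    [Anti K S R] [AntiInv K R S] (M : Type u) [AddCommGroup M] [Module R M] :
    M →ₗ[R] Du K S R (Du K R S M) :=
  flip (LinearMap.id : Du K R S M →ₗ[S] Du K R S M)

lemma ev_apply (m : M) (f : Du K R S M) : (ev K S M m) f = f m := rfl

lemma ev_inj : Function.Injective (ev (R := R) K S M) := by
  rw [← LinearMap.ker_eq_bot, LinearMap.ker_eq_bot']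
  intro x hx
  refine Du.sep (K := K) (R := R) S (fun f => ?_)
  exact congrArg (fun φ : Du K S R (Du K R S M) => φ f) hx

lemma ev_surj [FiniteDimensional K R] [Module.Finite R M] :
    Function.Surjective (ev (R := R) K S M) := by
  intro F
  let _ : Module K M := Module.compHom M (algebraMap K R)
  have : IsScalarTower K R M := ⟨fun c r b => by rw [Algebra.smul_def, mul_smul]; rfl⟩
  have : Module.Finite K M := Module.Finite.trans R M
  let u : Module.Dual K M → Du K R S M := fun φ =>
    Du.mk S φ (fun m n => _root_.map_add φ m n) (fun c m => φ.map_smul c m)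
  let G : Module.Dual K (Module.Dual K M) :=
    { toFun := fun φ => F (u φ)
      map_add' := fun φ ψ => by rw [← F.map_add]; rfl
      map_smul' := fun c φ => by
        have := F.map_alg c (u φ)
        refine Eq.trans ?_ this
        congr 1
        refine Du.ext fun m => ?_
        rw [Du.smul_apply, Anti.a_alg, Du.map_alg]
        rfl }
  obtain ⟨m, hm⟩ := (Module.evalEquiv K M).surjective G
  refine ⟨m, Du.ext fun f => ?_⟩
  have := LinearMap.congr_fun hm
    { toFun := f, map_add' := f.map_add, map_smul' := f.map_alg }
  exact this

lemma ev_nat (f : A →ₗ[R] B) : (ev K S B).comp f = (Dmap K R (Dmap K S f)).comp (ev K S A) := rfl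

/-- Evaluation as an isomorphism. -/
noncomputable def evE (K S : Type u) [Field K] [Algebra K R] [Ring S] [Algebra K S] [Anti K R S]
    [Anti K S R] [AntiInv K R S] (M : Type u) [AddCommGroup M] [Module R M]
    [FiniteDimensional K R] [Module.Finite R M] :
    M ≃ₗ[R] Du K S R (Du K R S M) := LinearEquiv.ofBijective (ev K S M) ⟨ev_inj, ev_surj⟩

lemma evE_apply [FiniteDimensional K R] [Module.Finite R M] (m : M) (f : Du K R S M) :
    (evE K S M m) f = f m := rfl

end
end Duality

section StarSec

/-- Generic `W_U`. -/
def WU {R : Type u} [Ring R] (T : Set (ModuleCat.{u} R)) : Set (ModuleCat.{u} R) :=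
  {M | M ∈ RPerp T ∧ ∀ N : ModuleCat.{u} R, N ∈ RPerp T → ∀ f : M →ₗ[R] N,
    ModuleCat.of R (N ⧸ LinearMap.range f) ∈ RPerp T}

/-- Generic `𝒰`. -/
def US {R : Type u} [Ring R] (T : Set (ModuleCat.{u} R)) : Set (ModuleCat.{u} R) :=
  {M | M ∈ WU T ∧ (∃ m : M, m ≠ 0) ∧
    ∀ N : Submodule R M, ModuleCat.of R N ∈ WU T → N = ⊥ ∨ N = ⊤}

section
variable {R : Type u} [Ring R] {T : Set (ModuleCat.{u} R)} {M N : Type u} [AddCommGroup M]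
  [Module R M] [AddCommGroup N] [Module R N]

lemma WU.sub (hM : ModuleCat.of R M ∈ WU T) (A : Submodule R M)
    (hA : ModuleCat.of R (M ⧸ A) ∈ RPerp T) : ModuleCat.of R A ∈ WU T := by
  refine ⟨RPerp.sub hM.1 A.subtype A.injective_subtype, fun G hG f => ?_⟩
  change A →ₗ[R] G at f
  obtain ⟨E, i', p', h, hi', hp', hip', h1, h2⟩ :=
    pushout A.subtype A.mkQ A.injective_subtype A.mkQ_surjective (by simp) f
  have hE : ModuleCat.of R E ∈ RPerp T := RPerp.ext i' p' hi' hip'.ge hG hA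
  have hq := hM.2 _ hE h
  refine RPerp.sub hq ((LinearMap.range f).mapQ (LinearMap.range h) i' ?_) ?_
  · rintro _ ⟨a, rfl⟩
    exact ⟨a, LinearMap.congr_fun h1 a⟩
  · rw [← LinearMap.ker_eq_bot, LinearMap.ker_eq_bot']
    intro x hx
    obtain ⟨x, rfl⟩ := (LinearMap.range f).mkQ_surjective x
    rw [Submodule.mkQ_apply, Submodule.mapQ_apply, Submodule.Quotient.mk_eq_zero] at hx
    obtain ⟨m, hm⟩ := hx
    change M at m
    change h m = i' x at hm
    have h3 : A.mkQ m = 0 := by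
      have h4 : p' (h m) = A.mkQ m := LinearMap.congr_fun h2 m
      rw [← h4, hm]
      have : i' x ∈ LinearMap.ker p' := hip' ▸ ⟨x, rfl⟩
      exact this
    rw [Submodule.mkQ_apply, Submodule.Quotient.mk_eq_zero] at h3
    rw [Submodule.mkQ_apply, Submodule.Quotient.mk_eq_zero]
    refine ⟨⟨m, h3⟩, hi' ?_⟩
    rw [← hm]
    exact (LinearMap.congr_fun h1 ⟨m, h3⟩).symm

lemma WU.quot (hM : ModuleCat.of R M ∈ RPerp T) (A : Submodule R M)
    (hA : ModuleCat.of R A ∈ WU T) : ModuleCat.of R (M ⧸ A) ∈ RPerp T := by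
  have := hA.2 (ModuleCat.of R M) hM A.subtype
  have h2 : LinearMap.range A.subtype = A := A.range_subtype
  exact RPerp.sub this (Submodule.quotEquivOfEq _ _ h2.symm).toLinearMap
    (Submodule.quotEquivOfEq _ _ h2.symm).injective

lemma WU.iso (e : M ≃ₗ[R] N) (hM : ModuleCat.of R M ∈ WU T) : ModuleCat.of R N ∈ WU T := by
  refine ⟨RPerp.sub hM.1 e.symm.toLinearMap e.symm.injective, fun G hG f => ?_⟩
  change N →ₗ[R] G at f
  have := hM.2 G hG (f.comp e.toLinearMap)
  have h2 : LinearMap.range (f.comp e.toLinearMap) = LinearMap.range f :=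
    LinearMap.range_comp_of_range_eq_top _ e.range
  exact RPerp.sub this (Submodule.quotEquivOfEq _ _ h2.symm).toLinearMap
    (Submodule.quotEquivOfEq _ _ h2.symm).injective

lemma US.iso (e : M ≃ₗ[R] N) (hM : ModuleCat.of R M ∈ US T) : ModuleCat.of R N ∈ US T := by
  refine ⟨WU.iso e hM.1, ?_, fun A hA => ?_⟩
  · obtain ⟨m, hm⟩ := hM.2.1
    exact ⟨e m, fun h => hm ((LinearEquiv.map_eq_zero_iff e).1 h)⟩
  · change Submodule R N at A
    have := hM.2.2 (A.map e.symm.toLinearMap) (WU.iso (e.symm.submoduleMap A) hA)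
    rcases this with h | h
    · left
      have h2 := congrArg (Submodule.map e.toLinearMap) h
      simpa [← Submodule.map_comp] using h2
    · right
      have h2 := congrArg (Submodule.map e.toLinearMap) h
      simpa [← Submodule.map_comp] using h2
end

variable {K R S : Type u} [Field K] [Ring R] [Algebra K R] [Ring S] [Algebra K S]
  [Anti K R S] [Anti K S R]

/-- The dual torsion class. -/
def Star (K : Type u) {R : Type u} (S : Type u) [Field K] [Ring R] [Algebra K R] [Ring S]
    [Algebra K S] [Anti K R S] [Anti K S R] (T : Set (ModuleCat.{u} R)) :
    Set (ModuleCat.{u} S) :=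
  {N | Module.Finite S N ∧ ModuleCat.of R (Du K S R N) ∈ RPerp T}

lemma tors_star (T : Set (ModuleCat.{u} R)) : Tors (Star K S T) where
  fin M hM := hM.1
  zero M hM := by
    refine ⟨tors_fin.zero M hM, fun X hX f => ?_⟩
    have : Subsingleton (Du K S R M) := Du.subsing'
    ext x
    exact Subsingleton.elim (α := Du K S R M) _ _
  quot M N f hf hM := ⟨tors_fin.quot M N f hf hM.1, RPerp.sub hM.2 (Dmap K R f) (Dmap_inj hf)⟩
  ext M A hA hC := ⟨tors_fin.ext M A hA.1 hC.1,
    RPerp.ext (Dmap K R A.mkQ) (Dmap K R A.subtype) (Dmap_inj A.mkQ_surjective)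
      (Dmap_exact _ _ (by simp)) hC.2 hA.2⟩

lemma star_anti {T T' : Set (ModuleCat.{u} R)} (h : T ⊆ T') : Star K S T' ⊆ Star K S T :=
  fun _ hN => ⟨hN.1, fun X hX f => hN.2 X (h hX) f⟩

variable [AntiInv K R S] [AntiInv K S R] [FiniteDimensional K R] [FiniteDimensional K S]
variable {T : Set (ModuleCat.{u} R)}

section
variable {M N A B : Type u} [AddCommGroup M] [Module R M] [AddCommGroup N] [Module S N]
 [AddCommGroup A] [Module R A] [AddCommGroup B] [Module R B]

lemma du_mem_star [Module.Finite R M] (h : ModuleCat.of R M ∈ RPerp T) :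
    ModuleCat.of S (Du K R S M) ∈ Star K S T :=
  ⟨Du.finite, RPerp.sub h (evE K S M).symm.toLinearMap (evE K S M).symm.injective⟩

lemma star_star (hT : Tors T) : Star K R (Star K S T) = T := by
  have : IsNoetherianRing R := IsNoetherianRing.of_finite K R
  ext M
  constructor
  · rintro ⟨hf, hM⟩
    obtain ⟨A, hA, hMA⟩ := radical (M := M) hT
    have h1 := RPerp.zero' hM (du_mem_star (K := K) (S := S) hMA) (Dmap K S A.mkQ)
    have h2 : A.mkQ = 0 := eq_zero_of_Dmap h1
    have h3 : A = ⊤ := by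
      have := A.ker_mkQ
      rw [h2, LinearMap.ker_zero] at this
      exact this.symm
    refine hT.quot _ _ A.subtype ?_ hA
    rw [← LinearMap.range_eq_top, Submodule.range_subtype, h3]
  · intro hM
    refine ⟨hT.fin M hM, fun N hN f => ?_⟩
    change N →ₗ[S] Du K R S M at f
    exact flip_eq_zero (RPerp.zero' (M := Du K S R N) (N := M) hN.2 hM (flip f))

lemma wl_star_iff (hT : Tors T) [hN : Module.Finite S N] :
    ModuleCat.of S N ∈ WL (Star K S T) ↔ ModuleCat.of R (Du K S R N) ∈ WU T := by
  have : IsNoetherianRing R := IsNoetherianRing.of_finite K R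
  have : IsNoetherianRing S := IsNoetherianRing.of_finite K S
  constructor
  · intro h
    refine ⟨h.1.2, fun G hG f X hX g => ?_⟩
    change Du K S R N →ₗ[R] G at f
    change X →ₗ[R] G ⧸ LinearMap.range f at g
    have hXf : Module.Finite R X := hT.fin X hX
    set G' : Submodule R G := (LinearMap.range g).comap (LinearMap.range f).mkQ with hG'
    have hfG : ∀ x, f x ∈ G' := fun x => by
      rw [hG', Submodule.mem_comap]
      have : (LinearMap.range f).mkQ (f x) = 0 := by simp
      rw [this]; exact zero_mem _
    let f' : Du K S R N →ₗ[R] G' := f.codRestrict G' hfG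
    let m : G' →ₗ[R] LinearMap.range g :=
      ((LinearMap.range f).mkQ.comp G'.subtype).codRestrict _ (fun x => x.2)
    have hm : Function.Surjective m := by
      rintro ⟨y, hy⟩
      obtain ⟨x, rfl⟩ := (LinearMap.range f).mkQ_surjective y
      exact ⟨⟨x, hy⟩, rfl⟩
    have hker : LinearMap.ker m ≤ LinearMap.range f' := by
      intro x hx
      have h1 : (LinearMap.range f).mkQ x.1 = 0 := congrArg Subtype.val hx
      rw [Submodule.mkQ_apply, Submodule.Quotient.mk_eq_zero] at h1
      obtain ⟨y, hy⟩ := h1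
      exact ⟨y, Subtype.ext hy⟩
    have hDN : Module.Finite R (Du K S R N) := Du.finite
    have hrg : Module.Finite R (LinearMap.range g) := inferInstance
    have hGf : Module.Finite R G' := tors_fin.ext' f' m hm hker hDN hrg
    have hGp : ModuleCat.of R G' ∈ RPerp T := RPerp.sub hG G'.subtype G'.injective_subtype
    let k : Du K R S G' →ₗ[S] N := (evE K R N).symm.toLinearMap.comp (Dmap K S f')
    have hk := WL.ker h (du_mem_star (K := K) (S := S) hGp) k
    let c : G' →ₗ[R] Du K S R (LinearMap.ker k) :=
      (Dmap K R (LinearMap.ker k).subtype).comp (ev K S G')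
    have hc0 : LinearMap.ker m ≤ LinearMap.ker c := by
      intro x hx
      obtain ⟨y, rfl⟩ := hker hx
      rw [LinearMap.mem_ker]
      refine Du.ext fun φ => ?_
      have hφ : k φ.1 = 0 := φ.2
      have hφ' : Dmap K S f' φ.1 = 0 := (LinearEquiv.map_eq_zero_iff (evE K R N).symm).1 hφ
      exact congrArg (fun t : Du K R S (Du K S R N) => t y) hφ'
    obtain ⟨ψ, hψ⟩ := factor m hm c hc0
    have hψ0 : ψ.comp g.rangeRestrict = 0 := RPerp.zero' (N := X) hk.2 hX _
    have hc : ∀ x, c x = 0 := by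
      intro x
      rw [← hψ]
      obtain ⟨y, hy⟩ := g.surjective_rangeRestrict (m x)
      rw [LinearMap.comp_apply, ← hy]
      exact LinearMap.congr_fun hψ0 y
    have hinj : Function.Injective (Dmap K S f') := by
      rw [← LinearMap.ker_eq_bot, LinearMap.ker_eq_bot']
      intro φ hφ
      have hφk : k φ = 0 := by simp [k, hφ]
      refine Du.ext fun x => ?_
      exact congrArg (fun t : Du K S R (LinearMap.ker k) => t ⟨φ, hφk⟩) (hc x)
    have hsurj := surj_of_Dmap_inj hinj
    ext x
    obtain ⟨y, hy⟩ := hm (g.rangeRestrict x)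
    obtain ⟨z, rfl⟩ := hsurj y
    have h5 : (LinearMap.range f).mkQ (f z) = g x := congrArg Subtype.val hy
    rw [← h5]; simp
  · intro h
    refine ⟨⟨hN, h.1⟩, fun N0 hN0 f => ?_⟩
    change N0 →ₗ[S] N at f
    have hf0 : Module.Finite S N0 := hN0.1
    refine ⟨(inferInstance : Module.Finite S (LinearMap.ker f)), ?_⟩
    have hq := h.2 _ hN0.2 (Dmap K R f)
    obtain ⟨ψ, hψ⟩ := factor (Dmap K R (LinearMap.ker f).subtype)
      (Dmap_surj (LinearMap.ker f).injective_subtype) (LinearMap.range (Dmap K R f)).mkQ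
      (by
        rw [Submodule.ker_mkQ]
        exact Dmap_exact _ _ (by simp))
    refine RPerp.sub hq ψ ?_
    rw [← LinearMap.ker_eq_bot, LinearMap.ker_eq_bot']
    intro y hy
    obtain ⟨z, rfl⟩ := Dmap_surj (K := K) (S := R) (LinearMap.ker f).injective_subtype y
    have h1 := LinearMap.congr_fun hψ z
    rw [LinearMap.comp_apply, hy] at h1
    have h2 : z ∈ LinearMap.range (Dmap K R f) := by
      rw [← Submodule.ker_mkQ (LinearMap.range (Dmap K R f))]; exact h1.symm
    obtain ⟨w, rfl⟩ := h2
    refine Du.ext fun x => ?_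
    rw [Dmap_apply, Dmap_apply]
    have : f ((LinearMap.ker f).subtype x) = 0 := x.2
    rw [this, w.map_zero]; rfl

lemma ds_star_iff (hT : Tors T) [hN : Module.Finite S N] :
    ModuleCat.of S N ∈ DS (Star K S T) ↔ ModuleCat.of R (Du K S R N) ∈ US T := by
  have : IsNoetherianRing R := IsNoetherianRing.of_finite K R
  have : IsNoetherianRing S := IsNoetherianRing.of_finite K S
  have hDN : Module.Finite R (Du K S R N) := Du.finite
  constructor
  · intro h
    refine ⟨(wl_star_iff hT).1 h.1, ?_, fun A hA => ?_⟩
    · by_contra hcon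
      push Not at hcon
      have : Subsingleton (Du K S R N) := ⟨fun a b => (hcon a).trans (hcon b).symm⟩
      exact DS.ne_zero h (Du.subsing this)
    · change Submodule R (Du K S R N) at A
      have hQ := WU.quot h.1.1.2 A hA
      let k : Du K R S (Du K S R N ⧸ A) →ₗ[S] N :=
        (evE K R N).symm.toLinearMap.comp (Dmap K S A.mkQ)
      have hk : Function.Injective k :=
        (evE K R N).symm.injective.comp (Dmap_inj A.mkQ_surjective)
      rcases DS.zero_or_surj (tors_star T) h (du_mem_star (K := K) (S := S) hQ) k with h0 | h1
      · right
        have : Subsingleton (Du K R S (Du K S R N ⧸ A)) :=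
          ⟨fun a b => hk (by rw [h0]; rfl)⟩
        exact Submodule.Quotient.subsingleton_iff.1 (Du.subsing this)
      · left
        have h2 : Function.Surjective (Dmap K S A.mkQ) := by
          intro y
          obtain ⟨x, hx⟩ := h1 ((evE K R N).symm y)
          exact ⟨x, (evE K R N).symm.injective hx⟩
        have := LinearMap.ker_eq_bot.2 (inj_of_Dmap_surj h2)
        rwa [Submodule.ker_mkQ] at this
  · intro h
    refine ⟨(wl_star_iff hT).2 h.1, ?_, fun A hA => ?_⟩
    · by_contra hcon
      push Not at hcon
      have : Subsingleton N := ⟨fun a b => (hcon a).trans (hcon b).symm⟩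
      have : Subsingleton (Du K S R N) := Du.subsing'
      obtain ⟨m, hm⟩ := h.2.1
      exact hm (Subsingleton.elim (α := Du K S R N) _ _)
    · change Submodule S N at A
      set B := LinearMap.ker (Dmap K R A.subtype) with hB
      have hB1 : ModuleCat.of R (Du K S R N ⧸ B) ∈ RPerp T :=
        RPerp.sub (RPerp.sub hA.1.2 (LinearMap.range (Dmap K R A.subtype)).subtype
          (Submodule.injective_subtype _))
          (Dmap K R A.subtype).quotKerEquivRange.toLinearMap
          (Dmap K R A.subtype).quotKerEquivRange.injective
      rcases h.2.2 B (WU.sub h.1 B hB1) with h0 | h1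
      · right
        have := surj_of_Dmap_inj (LinearMap.ker_eq_bot.1 h0)
        rw [← A.range_subtype]
        exact LinearMap.range_eq_top.2 this
      · left
        have := eq_zero_of_Dmap (LinearMap.ker_eq_top.1 h1)
        rw [← A.range_subtype, this, LinearMap.range_zero]
end

section
variable {X Y : Type u} [AddCommGroup X] [Module R X] [AddCommGroup Y] [Module R Y]

lemma ExtZ.of_dual [Module.Finite R Y]
    (h : ExtZ (ModuleCat.of S (Du K R S Y)) (ModuleCat.of S (Du K R S X))) :
    ExtZ (ModuleCat.of R X) (ModuleCat.of R Y) := by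
  intro E i p hi hp hip
  change Y →ₗ[R] E at i
  change E →ₗ[R] X at p
  obtain ⟨s, hs⟩ := h.split (Dmap K S p) (Dmap K S i) (Dmap_inj hp) (Dmap_surj hi)
    (le_antisymm (by
      rintro _ ⟨g, rfl⟩
      refine Du.ext fun y => ?_
      rw [Dmap_apply, Dmap_apply]
      have : i y ∈ LinearMap.ker p := hip ▸ ⟨y, rfl⟩
      rw [LinearMap.mem_ker.1 this, g.map_zero]; rfl) (Dmap_exact _ _ hip.ge))
  refine section_of_retraction i p hp hip
    ((evE K S Y).symm.toLinearMap.comp ((Dmap K R s).comp (ev K S E))) ?_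
  ext y
  apply (evE (R := R) K S Y).injective
  rw [LinearMap.comp_apply, LinearMap.comp_apply, LinearEquiv.coe_coe,
    LinearEquiv.apply_symm_apply]
  refine Du.ext fun φ => ?_
  exact congrArg (fun t : Du K R S Y => t y) (LinearMap.congr_fun hs φ)

lemma ExtZ.dual [Module.Finite R X] [Module.Finite R Y]
    (h : ExtZ (ModuleCat.of R X) (ModuleCat.of R Y)) :
    ExtZ (ModuleCat.of S (Du K R S Y)) (ModuleCat.of S (Du K R S X)) := by
  have : Module.Finite S (Du K R S X) := Du.finite
  exact ExtZ.of_dual (K := K) (R := S) (S := R) (h.iso (evE K S X) (evE K S Y))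
end

lemma HE.dual (K : Type u) {R : Type u} (S : Type u) [Field K] [Ring R] [Algebra K R] [Ring S]
    [Algebra K S] [Anti K R S] [Anti K S R] [AntiInv K R S] [AntiInv K S R]
    [FiniteDimensional K R] [FiniteDimensional K S] (hH : HE R) : HE S where
  quot X Y Y' hX hY f hf h := by
    have h1 : ExtZ (ModuleCat.of R (Du K S R Y)) (ModuleCat.of R (Du K S R X)) :=
      ExtZ.dual (X := X) (Y := Y) h
    have hY' : Module.Finite S Y' := Module.Finite.of_surjective f hf
    have h2 := hH.sub _ (ModuleCat.of R (Du K S R Y')) _ Du.finite Du.finite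
      (Dmap K R f) (Dmap_inj hf) h1
    exact ExtZ.of_dual (K := K) (S := R) (X := X) (Y := Y') h2
  sub X X' Y hX hY f hf h := by
    have h1 : ExtZ (ModuleCat.of R (Du K S R Y)) (ModuleCat.of R (Du K S R X)) :=
      ExtZ.dual (X := X) (Y := Y) h
    have h2 := hH.quot _ _ (ModuleCat.of R (Du K S R X')) Du.finite Du.finite
      (Dmap K R f) (Dmap_surj hf) h1
    exact ExtZ.of_dual (K := K) (S := R) (X := X') (Y := Y) h2

end StarSec

section PartTwo

lemma isLUB_dual {α β : Type*} [PartialOrder α] [PartialOrder β] (e : α ≃o βᵒᵈ) (x y : α) :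
    IsLUB (insert x {z | x ⋖ z}) y ↔
      IsGLB (insert (OrderDual.ofDual (e x)) {z | z ⋖ OrderDual.ofDual (e x)})
        (OrderDual.ofDual (e y)) := by
  rw [← e.isLUB_image']
  have : e '' (insert x {z | x ⋖ z}) = insert (e x) {z | e x ⋖ z} := by
    rw [Set.image_insert_eq]
    congr 1
    ext z
    constructor
    · rintro ⟨w, hw, rfl⟩
      exact (apply_covBy_apply_iff e).2 hw
    · intro hz
      refine ⟨e.symm z, ?_, e.apply_symm_apply z⟩
      refine (apply_covBy_apply_iff e).1 ?_
      rw [e.apply_symm_apply]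
      exact hz
  rw [this]
  have h2 : insert (OrderDual.ofDual (e x)) {z | z ⋖ OrderDual.ofDual (e x)} =
      OrderDual.toDual ⁻¹' (insert (e x) {z | e x ⋖ z}) := by
    ext z
    constructor
    · rintro (h | h)
      · left; rw [h]; rfl
      · have h' : z ⋖ OrderDual.ofDual (e x) := h
        have h3 : e x ⋖ OrderDual.toDual z := h'.toDual
        exact Or.inr h3
    · rintro (h | h)
      · left; exact congrArg OrderDual.ofDual h
      · have h' : e x ⋖ OrderDual.toDual z := h
        have h3 : z ⋖ OrderDual.ofDual (e x) := h'.ofDual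
        exact Or.inr h3
  rw [h2]
  rfl

variable {K R S : Type u} [Field K] [Ring R] [Algebra K R] [Ring S] [Algebra K S]
  [Anti K R S] [Anti K S R] [AntiInv K R S] [AntiInv K S R] [FiniteDimensional K R]
  [FiniteDimensional K S]

/-- Duality of lattices of torsion classes. -/
def starIso (K R S : Type u) [Field K] [Ring R] [Algebra K R] [Ring S] [Algebra K S]
    [Anti K R S] [Anti K S R] [AntiInv K R S] [AntiInv K S R] [FiniteDimensional K R]
    [FiniteDimensional K S] : TorsC R ≃o (TorsC S)ᵒᵈ where
  toFun T := OrderDual.toDual ⟨Star K S T.1, tors_star T.1⟩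
  invFun T := ⟨Star K R (OrderDual.ofDual T).1, tors_star _⟩
  left_inv T := Subtype.ext (star_star T.2)
  right_inv T := Subtype.ext (star_star (OrderDual.ofDual T).2)
  map_rel_iff' := by
    intro T T'
    constructor
    · intro h
      have h1 : Star K S T'.1 ⊆ Star K S T.1 := h
      have h2 := star_anti (K := K) (S := R) h1
      rw [star_star T.2, star_star T'.2] at h2
      exact h2
    · intro h
      exact star_anti (K := K) (S := S) h

lemma finite_dual (K : Type u) {R : Type u} (S : Type u) [Field K] [Ring R] [Algebra K R] [Ring S]
    [Algebra K S] [Anti K R S] [Anti K S R] [AntiInv K R S] [AntiInv K S R]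
    [FiniteDimensional K R] [FiniteDimensional K S] [h : Finite (TorsC R)] : Finite (TorsC S) :=
  (Finite.of_equiv (TorsC R) (starIso K R S).toEquiv : Finite (TorsC S)ᵒᵈ)

lemma tors_zero : Tors {M : ModuleCat.{u} R | Subsingleton M} where
  fin M hM := tors_fin.zero M hM
  zero M hM := hM
  quot M N f hf hM := by
    have : Subsingleton M := hM
    exact hf.subsingleton
  ext M A hA hC := by
    have h1 : Subsingleton A := hA
    have h2 : Subsingleton (M ⧸ A) := hC
    rw [Submodule.Quotient.subsingleton_iff] at h2
    rw [Submodule.subsingleton_iff_eq_bot] at h1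
    have h3 : Subsingleton (Submodule R M) := subsingleton_of_bot_eq_top (h1.symm.trans h2)
    exact (Submodule.subsingleton_iff R).1 h3

lemma us_fin (K : Type u) {R : Type u} (S : Type u) [Field K] [Ring R] [Algebra K R] [Ring S]
    [Algebra K S] [Anti K R S] [Anti K S R] [AntiInv K R S] [AntiInv K S R]
    [FiniteDimensional K R] [FiniteDimensional K S] [h : Finite (TorsC R)]
    {T : Set (ModuleCat.{u} R)} (hT : Tors T)
    (Y : ModuleCat.{u} R) (hY : Y ∈ US T) : Module.Finite R Y := by
  have : IsArtinianRing S := IsArtinianRing.of_finite K S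
  have : Finite (TorsC S) := finite_dual K (R := R) S
  obtain ⟨y, hy⟩ := hY.2.1
  set S0 : Set (ModuleCat.{u} R) := {M : ModuleCat.{u} R | Module.Finite R M} ∩ LPerp {Y} with hS0
  have hS0T : Tors S0 := tors_lperp {Y}
  have hTS : T ⊆ S0 := fun M hM => ⟨hT.fin M hM, fun X hX f => by
    cases hX; exact hY.1.1 M hM f⟩
  have hYS : Y ∈ RPerp S0 := fun M hM f => hM.2 Y rfl f
  have hex : ∃ N, N ∈ DS (Star K S S0) := by
    by_contra hcon
    push Not at hcon
    have h1 := le_of_DS (⟨Star K S S0, tors_star S0⟩ : TorsC S) ⟨_, tors_zero⟩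
      (fun N hN => absurd hN (hcon N))
    have hfin : Module.Finite R (Submodule.span R {y}) := inferInstance
    have h2 : ModuleCat.of S (Du K R S (Submodule.span R {y})) ∈ Star K S S0 :=
      du_mem_star (RPerp.sub (N := Y) hYS (Submodule.span R {y}).subtype
        (Submodule.injective_subtype _))
    have h3 : Subsingleton (Submodule.span R {y}) := Du.subsing (K := K) (S := S) (h1 h2)
    have h4 := h3.elim ⟨y, Submodule.mem_span_singleton_self y⟩ 0
    exact hy (congrArg Subtype.val h4)
  obtain ⟨N, hN⟩ := hex
  have hNf : Module.Finite S N := hN.1.1.1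
  have hB := ((ds_star_iff (N := N) hS0T).1 hN)
  have hBf : Module.Finite R (Du K S R N) := Du.finite
  have hg : ∃ g : Du K S R N →ₗ[R] Y, g ≠ 0 := by
    by_contra hcon
    push Not at hcon
    have h1 : ModuleCat.of R (Du K S R N) ∈ S0 := ⟨hBf, fun X hX f => by
      cases hX; exact hcon f⟩
    have h2 := RPerp.inter hB.1.1 h1
    obtain ⟨m, hm⟩ := hB.2.1
    exact hm (h2.elim m 0)
  obtain ⟨g, hg⟩ := hg
  have hq : ModuleCat.of R (Y ⧸ LinearMap.range g) ∈ RPerp T := fun X hX f =>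
    hB.1.2 Y hYS g X (hTS hX) f
  rcases hY.2.2 (LinearMap.range g) (WU.sub (M := Y) hY.1 _ hq) with h0 | h1
  · exact absurd (LinearMap.range_eq_bot.1 h0) hg
  · exact Module.Finite.of_surjective g (LinearMap.range_eq_top.1 h1)

lemma injective_du (P : Type u) [AddCommGroup P] [Module S P] [Module.Projective S P] :
    Module.Injective R (Du K S R P) where
  out X Y _ _ _ _ f hf g := by
    obtain ⟨l, hl⟩ := Module.projective_lifting_property (Dmap K S f) (flip g) (Dmap_surj hf)
    refine ⟨flip l, fun x => Du.ext fun p => ?_⟩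
    exact congrArg (fun t : Du K R S X => t x) (LinearMap.congr_fun hl p)

lemma no_injective (K : Type u) {R : Type u} (S : Type u) [Field K] [Ring R] [Algebra K R] [Ring S]
    [Algebra K S] [Anti K R S] [Anti K S R] [AntiInv K R S] [AntiInv K S R]
    [FiniteDimensional K R] [FiniteDimensional K S] [h : Finite (TorsC R)]
    {T : Set (ModuleCat.{u} R)} (T'' : TorsC S)
    (hT'' : Star K S T = Pop T''.1) (I : ModuleCat.{u} R) (hI : I ∈ RPerp T)
    (hinj : Module.Injective R I) : Subsingleton I := by
  have : IsArtinianRing S := IsArtinianRing.of_finite K S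
  have : Finite (TorsC S) := finite_dual K (R := R) S
  let C : Set (ModuleCat.{u} S) :=
    {N | Module.Finite S N ∧ ∀ φ : Du K S R N →ₗ[R] I, φ = 0}
  have hC : Tors C :=
    { fin := fun M hM => hM.1
      zero := fun M hM => ⟨tors_fin.zero M hM, fun φ => by
        have : Subsingleton (Du K S R M) := Du.subsing'
        ext x
        rw [Subsingleton.elim x 0, map_zero, map_zero]⟩
      quot := fun M N f hf hM => ⟨tors_fin.quot M N f hf hM.1, fun φ => by
        obtain ⟨ψ, hψ⟩ := hinj.out (Dmap K R f) (Dmap_inj hf) φ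
        ext x
        rw [← hψ, hM.2 ψ]; rfl⟩
      ext := fun M A hA hB => ⟨tors_fin.ext M A hA.1 hB.1, fun φ => by
        have h1 := hB.2 (φ.comp (Dmap K R A.mkQ))
        obtain ⟨ψ, hψ⟩ := factor (Dmap K R A.subtype) (Dmap_surj A.injective_subtype) φ (by
          intro x hx
          obtain ⟨z, rfl⟩ := Dmap_exact (K := K) (S := R) A.subtype A.mkQ (by simp) hx
          exact LinearMap.congr_fun h1 z)
        rw [← hψ, hA.2 ψ, LinearMap.zero_comp]⟩ }
  have hle : T'' ≤ (⟨C, hC⟩ : TorsC S) := by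
    refine le_of_DS _ _ (fun N hN => ?_)
    have hNf : Module.Finite S N := T''.2.fin N hN.1.1
    refine ⟨hNf, fun φ => ?_⟩
    have hDf : Module.Finite R (Du K S R N) := Du.finite
    have hJ : ModuleCat.of R (LinearMap.range φ) ∈ RPerp T :=
      RPerp.sub (N := I) hI (LinearMap.range φ).subtype (Submodule.injective_subtype _)
    have h1 : ModuleCat.of S (Du K R S (LinearMap.range φ)) ∈ Star K S T := du_mem_star hJ
    rw [hT''] at h1
    have h2 := LPerp.zero' (N := N) h1.2 hN
      ((evE K R N).symm.toLinearMap.comp (Dmap K S φ.rangeRestrict))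
    have h3 : Dmap K S φ.rangeRestrict = 0 := by
      ext1 x
      exact (LinearEquiv.map_eq_zero_iff (evE K R N).symm).1 (LinearMap.congr_fun h2 x)
    have h4 := eq_zero_of_Dmap h3
    ext x
    exact congrArg Subtype.val (LinearMap.congr_fun h4 x)
  have key : ∀ x : I, x = 0 := by
    intro x
    have h1 : ModuleCat.of S (Du K R S (Submodule.span R {x})) ∈ Star K S T :=
      du_mem_star (RPerp.sub (N := I) hI (Submodule.span R {x}).subtype
        (Submodule.injective_subtype _))
    rw [hT''] at h1
    have h2 := (hle h1.1).2 ((Submodule.span R {x}).subtype.comp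
      (evE K S (Submodule.span R {x})).symm.toLinearMap)
    have h3 := LinearMap.congr_fun h2
      (evE K S (Submodule.span R {x}) ⟨x, Submodule.mem_span_singleton_self x⟩)
    rw [LinearMap.comp_apply, LinearEquiv.coe_coe, LinearEquiv.symm_apply_apply] at h3
    exact h3
  exact ⟨fun a b => (key a).trans (key b).symm⟩

lemma part_two (K : Type u) {R : Type u} (S : Type u) [Field K] [Ring R] [Algebra K R] [Ring S]
    [Algebra K S] [Anti K R S] [Anti K S R] [AntiInv K R S] [AntiInv K S R]
    [FiniteDimensional K R] [FiniteDimensional K S] [h : Finite (TorsC R)]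
    (hH : HE R) (T : TorsC R) :
    (∃ T' : TorsC R, IsLUB (insert T' {z | T' ⋖ z}) T) ↔
      ((∀ Y ∈ US T.1, ∀ Y' ∈ US T.1, ExtZ Y Y') ∧
        ∀ I ∈ RPerp T.1, Module.Injective R I → Subsingleton I) := by
  have : IsArtinianRing S := IsArtinianRing.of_finite K S
  have : Finite (TorsC S) := finite_dual K (R := R) S
  have hHS : HE S := HE.dual K (R := R) S hH
  have h0 : (∃ T' : TorsC R, IsLUB (insert T' {z | T' ⋖ z}) T) ↔
      ∃ T'' : TorsC S, Star K S T.1 = Pop T''.1 := by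
    constructor
    · rintro ⟨T', hT'⟩
      rw [isLUB_dual (starIso K R S), isGLB_iff_pop] at hT'
      exact ⟨_, hT'⟩
    · rintro ⟨T'', hT''⟩
      refine ⟨(starIso K R S).symm (OrderDual.toDual T''), ?_⟩
      rw [isLUB_dual (starIso K R S), isGLB_iff_pop, OrderIso.apply_symm_apply]
      exact hT''
  rw [h0]
  constructor
  · rintro ⟨T'', hT''⟩
    refine ⟨fun Y hY Y' hY' => ?_, fun I hI hinj => no_injective K S T'' hT'' I hI hinj⟩
    have h1 := (part_one_mp hHS T'' _ hT'').1
    have hD : ∀ Y ∈ US T.1, ModuleCat.of S (Du K R S Y) ∈ DS (Star K S T.1) := by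
      intro Y hY
      have hYf : Module.Finite R Y := us_fin K S T.2 Y hY
      have : Module.Finite S (Du K R S Y) := Du.finite
      exact (ds_star_iff T.2).2 (US.iso (M := Y) (evE K S Y) hY)
    have hYf : Module.Finite R Y' := us_fin K S T.2 Y' hY'
    exact ExtZ.of_dual (K := K) (S := S) (X := Y) (Y := Y') (h1 _ (hD Y' hY') _ (hD Y hY))
  · rintro ⟨h1, h2⟩
    refine part_one_mpr K hHS ⟨Star K S T.1, tors_star T.1⟩ (fun X hX X' hX' => ?_)
      (fun P hP hPr => ?_)
    · have hf : Module.Finite S X := hX.1.1.1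
      have hf' : Module.Finite S X' := hX'.1.1.1
      exact ExtZ.of_dual (K := K) (S := R) (X := X) (Y := X')
        (h1 _ ((ds_star_iff (N := X') T.2).1 hX') _ ((ds_star_iff (N := X) T.2).1 hX))
    · have := h2 _ hP.2 (injective_du (K := K) (R := R) P)
      exact Du.subsing (K := K) (R := S) (S := R) (M := P) this
end PartTwo

/-- Transfer instance. -/
instance antiOp {K R : Type u} [Field K] [Ring R] [Algebra K R] : Anti K R Rᵐᵒᵖ where
  a := MulOpposite.unop
  a_add _ _ := rfl
  a_mul _ _ := rfl
  a_alg _ := rfl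

/-- Transfer instance. -/
instance antiOp' {K R : Type u} [Field K] [Ring R] [Algebra K R] : Anti K Rᵐᵒᵖ R where
  a := MulOpposite.op
  a_add _ _ := rfl
  a_mul _ _ := rfl
  a_alg _ := rfl

instance antiInvOp {K R : Type u} [Field K] [Ring R] [Algebra K R] : AntiInv K R Rᵐᵒᵖ where
  inv _ := rfl

instance antiInvOp' {K R : Type u} [Field K] [Ring R] [Algebra K R] : AntiInv K Rᵐᵒᵖ R where
  inv _ := rfl

section Final
variable {K : Type u} [Field K] {Λ : Type u} [Ring Λ] [Algebra K Λ]

lemma isFinDim_iff [FiniteDimensional K Λ] (M : RMod Λ) :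
    IsFinDim K Λ M ↔ Module.Finite Λᵐᵒᵖ M := by
  letI : Module K M := Module.compHom M (algebraMap K Λᵐᵒᵖ)
  have : IsScalarTower K Λᵐᵒᵖ M := ⟨fun c r b => by rw [Algebra.smul_def, mul_smul]; rfl⟩
  have : Module.Finite K Λᵐᵒᵖ := Module.Finite.equiv (MulOpposite.opLinearEquiv K)
  constructor
  · intro h
    have h' : Module.Finite K M := h
    exact Module.Finite.of_restrictScalars_finite K Λᵐᵒᵖ M
  · intro h
    have h' : Module.Finite K M := Module.Finite.trans Λᵐᵒᵖ M
    exact h'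

lemma isTorsionClass_iff [FiniteDimensional K Λ] (T : Set (RMod Λ)) :
    IsTorsionClass K Λ T ↔ Tors T := by
  constructor
  · intro h
    exact ⟨fun M hM => (isFinDim_iff M).1 (h.finDim M hM), h.zero_mem, h.quot_closed, h.ext_closed⟩
  · intro h
    exact ⟨fun M N e hM => h.iso (M := M) (N := N) e hM,
      fun M hM => (isFinDim_iff (K := K) M).2 (h.fin M hM), h.zero, h.quot, h.ext⟩

/-- Identification of the two lattices of torsion classes. -/
def torsIso (K : Type u) [Field K] (Λ : Type u) [Ring Λ] [Algebra K Λ] [FiniteDimensional K Λ] :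
    TorsionClass K Λ ≃o TorsC Λᵐᵒᵖ where
  toFun T := ⟨T.1, (isTorsionClass_iff T.1).1 T.2⟩
  invFun T := ⟨T.1, (isTorsionClass_iff T.1).2 T.2⟩
  left_inv T := rfl
  right_inv T := rfl
  map_rel_iff' := Iff.rfl

lemma isPopDown_iso {α β : Type*} [PartialOrder α] [PartialOrder β] (e : α ≃o β) (x y : α) :
    IsPopDown x y ↔ IsGLB (insert (e x) {z | z ⋖ e x}) (e y) := by
  unfold IsPopDown
  rw [← e.isGLB_image']
  have : e '' (insert x {z | z ⋖ x}) = insert (e x) {z | z ⋖ e x} := by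
    rw [Set.image_insert_eq]
    congr 1
    ext z
    constructor
    · rintro ⟨w, hw, rfl⟩
      exact (apply_covBy_apply_iff e).2 hw
    · intro hz
      refine ⟨e.symm z, ?_, e.apply_symm_apply z⟩
      refine (apply_covBy_apply_iff e).1 ?_
      rw [e.apply_symm_apply]
      exact hz
  rw [this]

lemma isPopUp_iso {α β : Type*} [PartialOrder α] [PartialOrder β] (e : α ≃o β) (x y : α) :
    IsPopUp x y ↔ IsLUB (insert (e x) {z | e x ⋖ z}) (e y) := by
  unfold IsPopUp
  rw [← e.isLUB_image']
  have : e '' (insert x {z | x ⋖ z}) = insert (e x) {z | e x ⋖ z} := by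
    rw [Set.image_insert_eq]
    congr 1
    ext z
    constructor
    · rintro ⟨w, hw, rfl⟩
      exact (apply_covBy_apply_iff e).2 hw
    · intro hz
      refine ⟨e.symm z, ?_, e.apply_symm_apply z⟩
      refine (apply_covBy_apply_iff e).1 ?_
      rw [e.apply_symm_apply]
      exact hz
  rw [this]

lemma no_nonzero_iff (C : Set (RMod Λ)) (P : RMod Λ → Prop) :
    (¬ ∃ M ∈ C, P M ∧ ∃ x : M, x ≠ 0) ↔ ∀ M ∈ C, P M → Subsingleton M := by
  constructor
  · intro h M hM hP
    have key : ∀ x : M, x = 0 := fun x => by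
      by_contra hx
      exact h ⟨M, hM, hP, x, hx⟩
    exact ⟨fun a b => (key a).trans (key b).symm⟩
  · rintro h ⟨M, hM, hP, x, hx⟩
    exact hx ((h M hM hP).elim x 0)

end Final

/-- Let `Λ` be a hereditary, τ-tilting finite finite-dimensional `K`-algebra
and `𝒯` a torsion class.  Then `𝒯` lies in the image of `pop↓` iff `Ext¹(X, X′) = 0` for all
`X, X′ ∈ 𝒟(𝒯)` (i.e. every short exact sequence `0 → X′ → E → X → 0` splits) and `𝒯` contains
no nonzero projective module; dually, `𝒯` lies in the image of `pop↑` iff `Ext¹(Y, Y′) = 0` for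
all `Y, Y′ ∈ 𝒰(𝒯)` and `𝒯⊥` contains no nonzero injective module. -/
theorem stmt2 [FiniteDimensional K Λ] (hfin : Finite (TorsionClass K Λ))
    (hher : ∀ P : RMod Λ, Module.Projective Λᵐᵒᵖ P →
      ∀ N : Submodule Λᵐᵒᵖ P, Module.Projective Λᵐᵒᵖ N)
    (T : TorsionClass K Λ) :
    ((∃ T' : TorsionClass K Λ, IsPopDown T' T) ↔
      ((∀ X ∈ DSet Λ T.1, ∀ X' ∈ DSet Λ T.1, ∀ (E : RMod Λ)
          (i : X' →ₗ[Λᵐᵒᵖ] E) (p : E →ₗ[Λᵐᵒᵖ] X),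
          Function.Injective i → Function.Surjective p →
          LinearMap.range i = LinearMap.ker p →
          ∃ s : X →ₗ[Λᵐᵒᵖ] E, p.comp s = LinearMap.id) ∧
        ¬ ∃ P ∈ T.1, Module.Projective Λᵐᵒᵖ P ∧ ∃ x : P, x ≠ 0)) ∧
    ((∃ T' : TorsionClass K Λ, IsPopUp T' T) ↔
      ((∀ Y ∈ USet Λ T.1, ∀ Y' ∈ USet Λ T.1, ∀ (E : RMod Λ)
          (i : Y' →ₗ[Λᵐᵒᵖ] E) (p : E →ₗ[Λᵐᵒᵖ] Y),
          Function.Injective i → Function.Surjective p →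
          LinearMap.range i = LinearMap.ker p →
          ∃ s : Y →ₗ[Λᵐᵒᵖ] E, p.comp s = LinearMap.id) ∧
        ¬ ∃ I ∈ Perp Λ T.1, Module.Injective Λᵐᵒᵖ I ∧ ∃ x : I, x ≠ 0)) := by
  have hf : FiniteDimensional K Λᵐᵒᵖ := Module.Finite.equiv (MulOpposite.opLinearEquiv K)
  have hf' : FiniteDimensional K Λᵐᵒᵖᵐᵒᵖ := Module.Finite.equiv (MulOpposite.opLinearEquiv K)
  have hArt : IsArtinianRing Λᵐᵒᵖ := IsArtinianRing.of_finite K Λᵐᵒᵖ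
  have hfin' : Finite (TorsC Λᵐᵒᵖ) := Finite.of_equiv _ (torsIso K Λ).toEquiv
  have hH : HE Λᵐᵒᵖ := HE.of_her hher
  refine ⟨?_, ?_⟩
  · rw [no_nonzero_iff]
    constructor
    · rintro ⟨T', hT'⟩
      rw [isPopDown_iso (torsIso K Λ), isGLB_iff_pop] at hT'
      exact part_one_mp hH _ _ hT'
    · rintro ⟨h1, h2⟩
      obtain ⟨T', hT'⟩ := part_one_mpr K hH (torsIso K Λ T) h1 h2
      refine ⟨(torsIso K Λ).symm T', ?_⟩
      rw [isPopDown_iso (torsIso K Λ), isGLB_iff_pop, OrderIso.apply_symm_apply]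
      exact hT'
  · rw [no_nonzero_iff]
    refine Iff.trans ?_ (part_two K Λᵐᵒᵖᵐᵒᵖ hH (torsIso K Λ T))
    constructor
    · rintro ⟨T', hT'⟩
      exact ⟨_, (isPopUp_iso (torsIso K Λ) _ _).1 hT'⟩
    · rintro ⟨T', hT'⟩
      refine ⟨(torsIso K Λ).symm T', ?_⟩
      rw [isPopUp_iso (torsIso K Λ), OrderIso.apply_symm_apply]
      exact hT'

end PaperTors
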